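/- arXiv:2509.26429 — 9 statements merged into one kernel-verified Lean document; each statement's English description precedes it below -/
import Mathlib

section
/- Identification over trajectories, per time step: for every t ≥ 1 and every (s₀,a₀) ∈ S×A, the sum over all tuples (s₁,a₁,…,s_t,a_t) ∈ (S×A)^t with πb(a_k|s_k) > 0 for all 1 ≤ k ≤ t of [Π_{k=1}^t P(s_k|s_{k−1},a_{k−1})·πb(a_k|s_k)] · [Π_{k=1}^t πe(a_k|s_k)/πb(a_k|s_k)] · r̄(s_t,a_t) equals Σ_{s'} p_{πe}^t(s'|s₀,a₀) · Σ_{a'} πe(a'|s') · r̄(s',a'). That is, the πb-expectation of the importance-weighted reward ρ_{1:t}·R̄_t equals the πe-expectation of the reward at time t. -/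
open Finset

/-- `t+1`-step state distribution `p_π^{t+1}(s'|s,a)`. -/
noncomputable def pstep {S A : Type*} [Fintype S] [Fintype A]
    (P : S → A → S → ℝ) (π : S → A → ℝ) : ℕ → S → A → S → ℝ
  | 0 => P
  | (t + 1) => fun s a s' =>
      ∑ s'' : S, ∑ a'' : A, pstep P π t s a s'' * π s'' a'' * P s'' a'' s'

/-- Extend a tuple `(s₁,a₁,…,s_t,a_t)` to a full history `k ↦ (s_k,a_k)` with
`(s₀,a₀)` at time `0` (and as a junk value outside `[0,t]`). -/
def extTraj {S A : Type*} (s₀ : S) (a₀ : A) {t : ℕ} (τ : Fin t → S × A) (k : ℕ) : S × A :=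
  if h : 0 < k ∧ k ≤ t then τ ⟨k - 1, by omega⟩ else (s₀, a₀)

theorem extTraj_snoc_le {S A : Type*} (s₀ : S) (a₀ : A) {n : ℕ} (τ : Fin n → S × A)
    (x : S × A) (k : ℕ) (hk : k ≤ n) :
    extTraj s₀ a₀ (Fin.snoc (α := fun _ => S × A) τ x) k = extTraj s₀ a₀ τ k := by
  unfold extTraj
  by_cases h : 0 < k
  · rw [dif_pos ⟨h, by omega⟩, dif_pos ⟨h, hk⟩]
    have : (⟨k - 1, by omega⟩ : Fin (n + 1)) = Fin.castSucc ⟨k - 1, by omega⟩ := rfl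
    rw [this, Fin.snoc_castSucc]
  · rw [dif_neg (by tauto), dif_neg (by tauto)]

theorem extTraj_snoc_last {S A : Type*} (s₀ : S) (a₀ : A) {n : ℕ} (τ : Fin n → S × A)
    (x : S × A) :
    extTraj s₀ a₀ (Fin.snoc (α := fun _ => S × A) τ x) (n + 1) = x := by
  unfold extTraj
  rw [dif_pos ⟨by omega, le_rfl⟩]
  exact Fin.snoc_last (α := fun _ => S × A) x τ

theorem sum_snoc {X : Type*} [Fintype X] {n : ℕ} (F : (Fin (n + 1) → X) → ℝ) :
    ∑ τ, F τ = ∑ τ : Fin n → X, ∑ x : X, F (Fin.snoc (α := fun _ => X) τ x) := by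
  rw [← (Fin.snocEquiv (fun _ : Fin (n + 1) => X)).sum_comp, Fintype.sum_prod_type,
    Finset.sum_comm]
  rfl

theorem traj_step {S A : Type*} [Fintype S] [Fintype A]
    (P : S → A → S → ℝ) (π : S → A → ℝ) (s₀ : S) (a₀ : A) (n : ℕ) (f : S → A → ℝ) :
    ∑ τ : Fin (n + 1) → S × A,
      (∏ k ∈ Finset.range (n + 1),
        P (extTraj s₀ a₀ τ k).1 (extTraj s₀ a₀ τ k).2 (extTraj s₀ a₀ τ (k + 1)).1 *
          π (extTraj s₀ a₀ τ (k + 1)).1 (extTraj s₀ a₀ τ (k + 1)).2) *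
        f (extTraj s₀ a₀ τ (n + 1)).1 (extTraj s₀ a₀ τ (n + 1)).2
    = ∑ τ : Fin n → S × A,
      (∏ k ∈ Finset.range n,
        P (extTraj s₀ a₀ τ k).1 (extTraj s₀ a₀ τ k).2 (extTraj s₀ a₀ τ (k + 1)).1 *
          π (extTraj s₀ a₀ τ (k + 1)).1 (extTraj s₀ a₀ τ (k + 1)).2) *
        ∑ s : S, P (extTraj s₀ a₀ τ n).1 (extTraj s₀ a₀ τ n).2 s * ∑ a : A, π s a * f s a := by
  rw [sum_snoc]
  refine Finset.sum_congr rfl fun τ _ => ?_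
  rw [Fintype.sum_prod_type, Finset.mul_sum]
  refine Finset.sum_congr rfl fun s _ => ?_
  rw [Finset.mul_sum, Finset.mul_sum]
  refine Finset.sum_congr rfl fun a _ => ?_
  rw [Finset.prod_range_succ, extTraj_snoc_last, extTraj_snoc_le _ _ _ _ n le_rfl]
  rw [Finset.prod_congr rfl (g := fun k =>
    P (extTraj s₀ a₀ τ k).1 (extTraj s₀ a₀ τ k).2 (extTraj s₀ a₀ τ (k + 1)).1 *
          π (extTraj s₀ a₀ τ (k + 1)).1 (extTraj s₀ a₀ τ (k + 1)).2)]
  · ring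
  · intro k hk
    have hk := Finset.mem_range.1 hk
    rw [extTraj_snoc_le _ _ _ _ k (by omega), extTraj_snoc_le _ _ _ _ (k + 1) (by omega)]

theorem traj_sum {S A : Type*} [Fintype S] [Fintype A]
    (P : S → A → S → ℝ) (π : S → A → ℝ) (s₀ : S) (a₀ : A) (n : ℕ) : ∀ (f : S → A → ℝ),
    ∑ τ : Fin (n + 1) → S × A,
      (∏ k ∈ Finset.range (n + 1),
        P (extTraj s₀ a₀ τ k).1 (extTraj s₀ a₀ τ k).2 (extTraj s₀ a₀ τ (k + 1)).1 *
          π (extTraj s₀ a₀ τ (k + 1)).1 (extTraj s₀ a₀ τ (k + 1)).2) *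
        f (extTraj s₀ a₀ τ (n + 1)).1 (extTraj s₀ a₀ τ (n + 1)).2
    = ∑ s' : S, pstep P π n s₀ a₀ s' * ∑ a' : A, π s' a' * f s' a' := by
  induction n with
  | zero =>
    intro f
    rw [traj_step]
    simp [extTraj, pstep]
  | succ n ih =>
    intro f
    rw [traj_step, ih (fun s'' a'' => ∑ s : S, P s'' a'' s * ∑ a : A, π s a * f s a)]
    obtain ⟨g, hg⟩ : ∃ g : S → ℝ, ∀ s, ∑ a : A, π s a * f s a = g s := ⟨_, fun _ => rfl⟩
    simp only [pstep, hg, Finset.mul_sum, Finset.sum_mul]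
    conv_rhs => rw [Finset.sum_comm]
    refine Finset.sum_congr rfl fun s'' _ => ?_
    rw [Finset.sum_comm]
    refine Finset.sum_congr rfl fun s _ => Finset.sum_congr rfl fun a _ => ?_
    ring

/-- identification over trajectories, per time step `t ≥ 1`:
the `πb`-expectation of the importance-weighted reward `ρ_{1:t}·R̄_t` equals the
`πe`-expectation of the reward at time `t`. -/
theorem identification_per_time_step
    (S A : Type*) [Fintype S] [Fintype A] [Nonempty S] [Nonempty A]
    (R0 : Finset ℝ)
    (P : S → A → S → ℝ) (hP0 : ∀ s a s', 0 ≤ P s a s')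
    (hP1 : ∀ s a, ∑ s' : S, P s a s' = 1)
    (pr : S → A → ℝ → ℝ) (hpr0 : ∀ s a, ∀ r ∈ R0, 0 ≤ pr s a r)
    (hpr1 : ∀ s a, ∑ r ∈ R0, pr s a r = 1)
    (rbar : S → A → ℝ) (hrbar : ∀ s a, rbar s a = ∑ r ∈ R0, r * pr s a r)
    (γ : ℝ) (hγ0 : 0 < γ) (hγ1 : γ < 1)
    (πb : S → A → ℝ) (hπb0 : ∀ s a, 0 ≤ πb s a) (hπb1 : ∀ s, ∑ a : A, πb s a = 1)
    (πe : S → A → ℝ) (hπe0 : ∀ s a, 0 ≤ πe s a) (hπe1 : ∀ s, ∑ a : A, πe s a = 1)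
    (hpos : ∀ s a, 0 < πe s a → 0 < πb s a)
    (t : ℕ) (ht : 1 ≤ t) (s₀ : S) (a₀ : A) :
    (∑ τ : Fin t → S × A,
      if ∀ k : Fin t, 0 < πb (τ k).1 (τ k).2 then
        (∏ k ∈ Finset.range t,
            P (extTraj s₀ a₀ τ k).1 (extTraj s₀ a₀ τ k).2 (extTraj s₀ a₀ τ (k + 1)).1 *
              πb (extTraj s₀ a₀ τ (k + 1)).1 (extTraj s₀ a₀ τ (k + 1)).2) *
        (∏ k ∈ Finset.range t,
            πe (extTraj s₀ a₀ τ (k + 1)).1 (extTraj s₀ a₀ τ (k + 1)).2 /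
              πb (extTraj s₀ a₀ τ (k + 1)).1 (extTraj s₀ a₀ τ (k + 1)).2) *
        rbar (extTraj s₀ a₀ τ t).1 (extTraj s₀ a₀ τ t).2
      else 0)
    = ∑ s' : S, pstep P πe (t - 1) s₀ a₀ s' * ∑ a' : A, πe s' a' * rbar s' a' := by
  obtain ⟨n, rfl⟩ : ∃ n, t = n + 1 := ⟨t - 1, by omega⟩
  rw [Nat.add_sub_cancel, ← traj_sum]
  refine Finset.sum_congr rfl fun τ _ => ?_
  have hext : ∀ k (hk : k < n + 1), extTraj s₀ a₀ τ (k + 1) = τ ⟨k, hk⟩ := by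
    intro k hk
    unfold extTraj
    rw [dif_pos ⟨by omega, by omega⟩]
    rfl
  split_ifs with h
  · rw [← Finset.prod_mul_distrib]
    congr 1
    refine Finset.prod_congr rfl fun k hk => ?_
    have hb := h ⟨k, Finset.mem_range.1 hk⟩
    rw [← hext] at hb
    field_simp
  · push Not at h
    obtain ⟨k, hk⟩ := h
    have he : πe (τ k).1 (τ k).2 = 0 := by
      refine le_antisymm (not_lt.1 fun h' => ?_) (hπe0 _ _)
      exact absurd (hpos _ _ h') (not_lt.2 hk)
    rw [Finset.prod_eq_zero (Finset.mem_range.2 k.2), zero_mul]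
    rw [hext k.1 k.2]
    simp [he]
end

section
/- Identification over trajectories (full): for every (s,a) ∈ S×A, the series r̄(s,a) + Σ_{t=1}^∞ γ^t · ( Σ over tuples (s₁,a₁,…,s_t,a_t) ∈ (S×A)^t with πb(a_k|s_k) > 0 for all k, starting from (s₀,a₀) = (s,a), of [Π_{k=1}^t P(s_k|s_{k−1},a_{k−1})·πb(a_k|s_k)] · [Π_{k=1}^t πe(a_k|s_k)/πb(a_k|s_k)] · r̄(s_t,a_t) ) converges absolutely and its sum equals Q_{πe}(s,a). That is, Q_{πe}(s,a) equals the πb-expectation of R₀ + Σ_{t≥1} γ^t ρ_{1:t} R_t given S₀ = s, A₀ = a, where ρ_{1:t} is the cumulative importance ratio Π_{k=1}^t πe(a_k|s_k)/πb(a_k|s_k). -/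
open Finset

/-- The `πb`-expectation of the importance-weighted reward `ρ_{1:t}·R̄_t` at time `t`,
starting from `(s₀,a₀)`: a sum over tuples `(s₁,a₁,…,s_t,a_t)` with `πb(a_k|s_k) > 0`. -/
noncomputable def ipwSum {S A : Type*} [Fintype S] [Fintype A]
    (P : S → A → S → ℝ) (πb πe : S → A → ℝ) (rbar : S → A → ℝ)
    (t : ℕ) (s₀ : S) (a₀ : A) : ℝ :=
  ∑ τ : Fin t → S × A,
    if ∀ k : Fin t, 0 < πb (τ k).1 (τ k).2 then
      (∏ k ∈ Finset.range t,
          P (extTraj s₀ a₀ τ k).1 (extTraj s₀ a₀ τ k).2 (extTraj s₀ a₀ τ (k + 1)).1 *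
            πb (extTraj s₀ a₀ τ (k + 1)).1 (extTraj s₀ a₀ τ (k + 1)).2) *
      (∏ k ∈ Finset.range t,
          πe (extTraj s₀ a₀ τ (k + 1)).1 (extTraj s₀ a₀ τ (k + 1)).2 /
            πb (extTraj s₀ a₀ τ (k + 1)).1 (extTraj s₀ a₀ τ (k + 1)).2) *
      rbar (extTraj s₀ a₀ τ t).1 (extTraj s₀ a₀ τ t).2
    else 0

theorem extTraj_cons {S A : Type*} (s : S) (a : A) {t : ℕ} (x : S × A) (τ : Fin t → S × A)
    (k : ℕ) (hk : k ≤ t) :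
    extTraj s a (Fin.cons x τ : Fin (t + 1) → S × A) (k + 1) = extTraj x.1 x.2 τ k := by
  unfold extTraj
  rcases k with _ | k
  · simp
  · have h1 : 0 < k + 1 + 1 ∧ k + 1 + 1 ≤ t + 1 := by omega
    have h2 : 0 < k + 1 ∧ k + 1 ≤ t := by omega
    rw [dif_pos h1, dif_pos h2]
    exact Fin.cons_succ (α := fun _ => S × A) x τ ⟨k, by omega⟩

theorem extTraj_zero {S A : Type*} (s : S) (a : A) {t : ℕ} (τ : Fin t → S × A) :
    extTraj s a τ 0 = (s, a) := by
  simp [extTraj]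

theorem ipwSum_zero {S A : Type*} [Fintype S] [Fintype A]
    (P : S → A → S → ℝ) (πb πe : S → A → ℝ) (rbar : S → A → ℝ) (s : S) (a : A) :
    ipwSum P πb πe rbar 0 s a = rbar s a := by
  simp [ipwSum, extTraj]

theorem ipwSum_succ {S A : Type*} [Fintype S] [Fintype A]
    (P : S → A → S → ℝ) (πb πe : S → A → ℝ) (rbar : S → A → ℝ)
    (hπe0 : ∀ s a, 0 ≤ πe s a) (hpos : ∀ s a, 0 < πe s a → 0 < πb s a)
    (t : ℕ) (s : S) (a : A) :
    ipwSum P πb πe rbar (t + 1) s a =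
      ∑ s' : S, P s a s' * ∑ a' : A, πe s' a' * ipwSum P πb πe rbar t s' a' := by
  have hR : (∑ s' : S, P s a s' * ∑ a' : A, πe s' a' * ipwSum P πb πe rbar t s' a') =
      ∑ x : S × A, P s a x.1 * (πe x.1 x.2 * ipwSum P πb πe rbar t x.1 x.2) := by
    rw [Fintype.sum_prod_type]
    simp only [Finset.mul_sum]
  rw [hR]
  conv_lhs => unfold ipwSum
  rw [← (Fin.consEquiv (fun _ : Fin (t + 1) => S × A)).sum_comp, Fintype.sum_prod_type]
  refine Finset.sum_congr rfl fun x _ => ?_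
  unfold ipwSum
  rw [Finset.mul_sum, Finset.mul_sum]
  refine Finset.sum_congr rfl fun τ _ => ?_
  have hσ0 : (Fin.consEquiv (fun _ : Fin (t + 1) => S × A)) (x, τ) 0 = x := rfl
  have hσs : ∀ k : Fin t,
      (Fin.consEquiv (fun _ : Fin (t + 1) => S × A)) (x, τ) k.succ = τ k := fun _ => rfl
  have hσ : ∀ k ≤ t, extTraj s a ((Fin.consEquiv (fun _ : Fin (t + 1) => S × A)) (x, τ)) (k + 1)
      = extTraj x.1 x.2 τ k := extTraj_cons s a x τ
  generalize (Fin.consEquiv (fun _ : Fin (t + 1) => S × A)) (x, τ) = σ at *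
  simp only [Fin.forall_fin_succ, hσ0, hσs]
  by_cases hx : 0 < πb x.1 x.2
  · by_cases hτ : ∀ k : Fin t, 0 < πb (τ k).1 (τ k).2
    · rw [if_pos ⟨hx, hτ⟩, if_pos hτ, Finset.prod_range_succ', Finset.prod_range_succ']
      have e1 : ∀ k ∈ Finset.range t,
          extTraj s a σ (k + 1) = extTraj x.1 x.2 τ k :=
        fun k hk => hσ k (Finset.mem_range.1 hk).le
      have e2 : ∀ k ∈ Finset.range t,
          extTraj s a σ (k + 1 + 1) = extTraj x.1 x.2 τ (k + 1) :=
        fun k hk => hσ (k + 1) (Finset.mem_range.1 hk)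
      rw [Finset.prod_congr (g := fun k => P (extTraj x.1 x.2 τ k).1 (extTraj x.1 x.2 τ k).2
          (extTraj x.1 x.2 τ (k + 1)).1 * πb (extTraj x.1 x.2 τ (k + 1)).1
          (extTraj x.1 x.2 τ (k + 1)).2) rfl fun k hk => by rw [e1 k hk, e2 k hk],
        Finset.prod_congr (f := fun k => πe (extTraj s a σ (k + 1 + 1)).1
          (extTraj s a σ (k + 1 + 1)).2 / πb (extTraj s a σ (k + 1 + 1)).1
          (extTraj s a σ (k + 1 + 1)).2) (g := fun k => πe (extTraj x.1 x.2 τ (k + 1)).1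
          (extTraj x.1 x.2 τ (k + 1)).2 / πb (extTraj x.1 x.2 τ (k + 1)).1
          (extTraj x.1 x.2 τ (k + 1)).2) rfl fun k hk => by rw [e2 k hk],
        hσ t le_rfl, hσ 0 (Nat.zero_le _),
        extTraj_zero, extTraj_zero]
      have := hx.ne'
      dsimp only
      generalize (∏ k ∈ Finset.range t, _ : ℝ) = U
      generalize (∏ k ∈ Finset.range t, _ : ℝ) = V
      field_simp
    · rw [if_neg (fun h => hτ h.2), if_neg hτ]; simp
  · have h0 : πe x.1 x.2 = 0 :=
      le_antisymm (not_lt.1 fun h => hx (hpos _ _ h)) (hπe0 _ _)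
    rw [if_neg (fun h => hx h.1), h0]; simp

theorem avg_bound {S A : Type*} [Fintype S] [Fintype A]
    (P : S → A → S → ℝ) (hP0 : ∀ s a s', 0 ≤ P s a s')
    (hP1 : ∀ s a, ∑ s' : S, P s a s' = 1)
    (πe : S → A → ℝ) (hπe0 : ∀ s a, 0 ≤ πe s a) (hπe1 : ∀ s, ∑ a : A, πe s a = 1)
    (f : S → A → ℝ) (C : ℝ) (hf : ∀ s a, |f s a| ≤ C) (s : S) (a : A) :
    |∑ s' : S, P s a s' * ∑ a' : A, πe s' a' * f s' a'| ≤ C := by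
  have h1 : ∀ s', |∑ a' : A, πe s' a' * f s' a'| ≤ C := fun s' =>
    calc |∑ a' : A, πe s' a' * f s' a'| ≤ ∑ a' : A, |πe s' a' * f s' a'| :=
          Finset.abs_sum_le_sum_abs _ _
      _ ≤ ∑ a' : A, πe s' a' * C := Finset.sum_le_sum fun a' _ => by
          rw [abs_mul, abs_of_nonneg (hπe0 s' a')]
          exact mul_le_mul_of_nonneg_left (hf _ _) (hπe0 _ _)
      _ = C := by rw [← Finset.sum_mul, hπe1, one_mul]
  calc |∑ s' : S, P s a s' * ∑ a' : A, πe s' a' * f s' a'|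
        ≤ ∑ s' : S, |P s a s' * ∑ a' : A, πe s' a' * f s' a'| :=
          Finset.abs_sum_le_sum_abs _ _
      _ ≤ ∑ s' : S, P s a s' * C := Finset.sum_le_sum fun s' _ => by
          rw [abs_mul, abs_of_nonneg (hP0 s a s')]
          exact mul_le_mul_of_nonneg_left (h1 _) (hP0 _ _ _)
      _ = C := by rw [← Finset.sum_mul, hP1, one_mul]

theorem exists_abs_bound {S A : Type*} [Fintype S] [Fintype A] (f : S → A → ℝ) :
    ∃ C, ∀ s a, |f s a| ≤ C :=
  ⟨∑ s, ∑ a, |f s a|, fun s a =>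
    (Finset.single_le_sum (f := fun a => |f s a|) (fun _ _ => abs_nonneg _)
      (Finset.mem_univ a)).trans
    (Finset.single_le_sum (f := fun s => ∑ a, |f s a|)
      (fun _ _ => Finset.sum_nonneg fun _ _ => abs_nonneg _) (Finset.mem_univ s))⟩

/-- identification over trajectories (full): the series
`r̄(s,a) + Σ_{t≥1} γ^t · E_{πb}[ρ_{1:t} R̄_t | S₀=s, A₀=a]` converges absolutely and
its sum equals `Q_{πe}(s,a)`, where `Q_{πe}` is the (unique) fixed point of the
Bellman operator of `πe`. -/
theorem identification_over_trajectories_full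
    (S A : Type*) [Fintype S] [Fintype A] [Nonempty S] [Nonempty A]
    (R0 : Finset ℝ)
    (P : S → A → S → ℝ) (hP0 : ∀ s a s', 0 ≤ P s a s')
    (hP1 : ∀ s a, ∑ s' : S, P s a s' = 1)
    (pr : S → A → ℝ → ℝ) (hpr0 : ∀ s a, ∀ r ∈ R0, 0 ≤ pr s a r)
    (hpr1 : ∀ s a, ∑ r ∈ R0, pr s a r = 1)
    (rbar : S → A → ℝ) (hrbar : ∀ s a, rbar s a = ∑ r ∈ R0, r * pr s a r)
    (γ : ℝ) (hγ0 : 0 < γ) (hγ1 : γ < 1)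
    (πb : S → A → ℝ) (hπb0 : ∀ s a, 0 ≤ πb s a) (hπb1 : ∀ s, ∑ a : A, πb s a = 1)
    (πe : S → A → ℝ) (hπe0 : ∀ s a, 0 ≤ πe s a) (hπe1 : ∀ s, ∑ a : A, πe s a = 1)
    (hpos : ∀ s a, 0 < πe s a → 0 < πb s a)
    (Q : S → A → ℝ)
    (hQ : ∀ s a, Q s a =
      rbar s a + γ * ∑ s' : S, P s a s' * ∑ a' : A, πe s' a' * Q s' a') :
    (∀ s a, Summable fun t : ℕ => |γ ^ (t + 1) * ipwSum P πb πe rbar (t + 1) s a|)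
    ∧ ∀ s a,
        rbar s a + (∑' t : ℕ, γ ^ (t + 1) * ipwSum P πb πe rbar (t + 1) s a) = Q s a := by
  obtain ⟨M, hM⟩ := exists_abs_bound rbar
  obtain ⟨C, hC⟩ := exists_abs_bound Q
  have hsucc := ipwSum_succ P πb πe rbar hπe0 hpos
  have hb : ∀ t s a, |ipwSum P πb πe rbar t s a| ≤ M := by
    intro t
    induction t with
    | zero => intro s a; rw [ipwSum_zero]; exact hM s a
    | succ t ih =>
      intro s a
      rw [hsucc]
      exact avg_bound P hP0 hP1 πe hπe0 hπe1 _ M ih s a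
  have hsum : ∀ s a, Summable fun t : ℕ => |γ ^ t * ipwSum P πb πe rbar t s a| := by
    intro s a
    refine Summable.of_nonneg_of_le (fun _ => abs_nonneg _) (fun t => ?_)
      ((summable_geometric_of_lt_one hγ0.le hγ1).mul_right M)
    rw [abs_mul, abs_of_nonneg (pow_nonneg hγ0.le t)]
    exact mul_le_mul_of_nonneg_left (hb t s a) (pow_nonneg hγ0.le t)
  have herr : ∀ n s a,
      |Q s a - ∑ t ∈ Finset.range n, γ ^ t * ipwSum P πb πe rbar t s a| ≤ γ ^ n * C := by
    intro n
    induction n with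
    | zero => intro s a; simpa using hC s a
    | succ n ih =>
      intro s a
      have key : Q s a - ∑ t ∈ Finset.range (n + 1), γ ^ t * ipwSum P πb πe rbar t s a =
          γ * ∑ s' : S, P s a s' * ∑ a' : A, πe s' a' *
            (Q s' a' - ∑ t ∈ Finset.range n, γ ^ t * ipwSum P πb πe rbar t s' a') := by
        have h2 : ∑ t ∈ Finset.range n, γ ^ (t + 1) * ipwSum P πb πe rbar (t + 1) s a =
            γ * ∑ s' : S, P s a s' * ∑ a' : A, πe s' a' *
              ∑ t ∈ Finset.range n, γ ^ t * ipwSum P πb πe rbar t s' a' := by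
          simp only [hsucc, Finset.mul_sum]
          rw [Finset.sum_comm]
          refine Finset.sum_congr rfl fun s' _ => ?_
          rw [Finset.sum_comm]
          refine Finset.sum_congr rfl fun a' _ => Finset.sum_congr rfl fun t _ => ?_
          ring
        rw [Finset.sum_range_succ', h2, ipwSum_zero, hQ s a]
        simp only [mul_sub, Finset.sum_sub_distrib]
        ring
      rw [key, abs_mul, abs_of_pos hγ0, pow_succ', mul_assoc]
      exact mul_le_mul_of_nonneg_left
        (avg_bound P hP0 hP1 πe hπe0 hπe1 _ _ ih s a) hγ0.le
  refine ⟨fun s a => (summable_nat_add_iff 1).2 (hsum s a), fun s a => ?_⟩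
  have hs : Summable fun t : ℕ => γ ^ t * ipwSum P πb πe rbar t s a := (hsum s a).of_abs
  have h3 := hs.tsum_eq_zero_add
  rw [pow_zero, one_mul, ipwSum_zero] at h3
  rw [← h3]
  refine tendsto_nhds_unique hs.hasSum.tendsto_sum_nat ?_
  have h4 : Filter.Tendsto (fun n : ℕ => γ ^ n * C) Filter.atTop (nhds 0) := by
    simpa using (tendsto_pow_atTop_nhds_zero_of_lt_one hγ0.le hγ1).mul_const C
  have h5 := squeeze_zero_norm (f := fun n : ℕ =>
    Q s a - ∑ t ∈ Finset.range n, γ ^ t * ipwSum P πb πe rbar t s a) (fun n => herr n s a) h4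
  simpa using h5.const_sub (Q s a)
end

section
/- Bellman-residual telescoping: let πe be a policy. For every q : S×A → ℝ and every (s,a) ∈ S×A, Q_{πe}(s,a) − q(s,a) = (T_{πe}q − q)(s,a) + Σ_{t=1}^∞ γ^t · Σ_{s'} p_{πe}^t(s'|s,a) · Σ_{a'} πe(a'|s') · (T_{πe}q − q)(s',a'), with the series on the right converging absolutely. -/
open Finset

/-- Bellman operator of a policy `π` (curried form). -/
noncomputable def bellmanC {S A : Type*} [Fintype S] [Fintype A]
    (P : S → A → S → ℝ) (rbar : S → A → ℝ) (γ : ℝ) (π : S → A → ℝ)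
    (q : S → A → ℝ) : S → A → ℝ :=
  fun s a => rbar s a + γ * ∑ s' : S, P s a s' * ∑ a' : A, π s' a' * q s' a'

lemma pstep_nonneg_aux {S A : Type*} [Fintype S] [Fintype A]
    (P : S → A → S → ℝ) (hP0 : ∀ s a s', 0 ≤ P s a s')
    (π : S → A → ℝ) (hπ0 : ∀ s a, 0 ≤ π s a) (t : ℕ) (s : S) (a : A) :
    ∀ s', 0 ≤ pstep P π t s a s' := by
  induction t with
  | zero => intro s'; exact hP0 s a s'
  | succ t ih =>
    intro s'
    simp only [pstep]
    exact Finset.sum_nonneg fun x _ => Finset.sum_nonneg fun y _ =>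
      mul_nonneg (mul_nonneg (ih x) (hπ0 x y)) (hP0 x y s')

lemma pstep_succ_sum_aux {S A : Type*} [Fintype S] [Fintype A]
    (P : S → A → S → ℝ) (π : S → A → ℝ) (t : ℕ) (s : S) (a : A) (g : S → ℝ) :
    ∑ s', pstep P π (t + 1) s a s' * g s'
      = ∑ s', pstep P π t s a s' * ∑ a', π s' a' * ∑ x, P s' a' x * g x := by
  simp only [pstep, Finset.sum_mul, Finset.mul_sum]
  rw [Finset.sum_comm]
  refine Finset.sum_congr rfl fun x _ => ?_
  rw [Finset.sum_comm]
  refine Finset.sum_congr rfl fun y _ => Finset.sum_congr rfl fun z _ => ?_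
  ring

lemma pstep_sum_aux {S A : Type*} [Fintype S] [Fintype A]
    (P : S → A → S → ℝ) (hP1 : ∀ s a, ∑ s' : S, P s a s' = 1)
    (π : S → A → ℝ) (hπ1 : ∀ s, ∑ a : A, π s a = 1) (t : ℕ) (s : S) (a : A) :
    ∑ s', pstep P π t s a s' = 1 := by
  induction t with
  | zero => exact hP1 s a
  | succ t ih =>
    have h := pstep_succ_sum_aux P π t s a (fun _ => 1)
    simp only [mul_one, hP1, hπ1] at h
    rw [h, ih]

lemma avg_bound_aux {ι : Type*} [Fintype ι] (w f : ι → ℝ) (hw : ∀ i, 0 ≤ w i)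
    (h1 : ∑ i, w i = 1) (C : ℝ) (hf : ∀ i, |f i| ≤ C) : |∑ i, w i * f i| ≤ C := by
  calc |∑ i, w i * f i| ≤ ∑ i, |w i * f i| := Finset.abs_sum_le_sum_abs _ _
    _ ≤ ∑ i, w i * C := by
        refine Finset.sum_le_sum fun i _ => ?_
        rw [abs_mul, abs_of_nonneg (hw i)]
        exact mul_le_mul_of_nonneg_left (hf i) (hw i)
    _ = C := by rw [← Finset.sum_mul, h1, one_mul]

/-- Bellman-residual telescoping: for every `q` and every `(s,a)`,
`Q_{πe}(s,a) − q(s,a) = (T_{πe}q − q)(s,a) + Σ_{t≥1} γ^t Σ_{s'} p_{πe}^t(s'|s,a) Σ_{a'} πe(a'|s')·(T_{πe}q − q)(s',a')`,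
with the series converging absolutely. -/
theorem bellman_residual_telescoping
    (S A : Type*) [Fintype S] [Fintype A] [Nonempty S] [Nonempty A]
    (R0 : Finset ℝ)
    (P : S → A → S → ℝ) (hP0 : ∀ s a s', 0 ≤ P s a s')
    (hP1 : ∀ s a, ∑ s' : S, P s a s' = 1)
    (pr : S → A → ℝ → ℝ) (hpr0 : ∀ s a, ∀ r ∈ R0, 0 ≤ pr s a r)
    (hpr1 : ∀ s a, ∑ r ∈ R0, pr s a r = 1)
    (rbar : S → A → ℝ) (hrbar : ∀ s a, rbar s a = ∑ r ∈ R0, r * pr s a r)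
    (γ : ℝ) (hγ0 : 0 < γ) (hγ1 : γ < 1)
    (πe : S → A → ℝ) (hπe0 : ∀ s a, 0 ≤ πe s a) (hπe1 : ∀ s, ∑ a : A, πe s a = 1)
    (Q : S → A → ℝ) (hQ : ∀ s a, Q s a = bellmanC P rbar γ πe Q s a)
    (q : S → A → ℝ) (s : S) (a : A) :
    Summable (fun t : ℕ =>
      |γ ^ (t + 1) * ∑ s' : S, pstep P πe t s a s' *
          ∑ a' : A, πe s' a' * (bellmanC P rbar γ πe q s' a' - q s' a')|)
    ∧ Q s a - q s a
        = (bellmanC P rbar γ πe q s a - q s a) +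
          ∑' t : ℕ, γ ^ (t + 1) * ∑ s' : S, pstep P πe t s a s' *
            ∑ a' : A, πe s' a' * (bellmanC P rbar γ πe q s' a' - q s' a') := by
  have key : ∀ f : S → A → ℝ, ∃ C : ℝ, ∀ t : ℕ,
      |∑ s' : S, pstep P πe t s a s' * ∑ a' : A, πe s' a' * f s' a'| ≤ C := by
    intro f
    refine ⟨∑ x, ∑ y, |f x y|, fun t => ?_⟩
    refine avg_bound_aux _ _ (pstep_nonneg_aux P hP0 πe hπe0 t s a)
      (pstep_sum_aux P hP1 πe hπe1 t s a) _ fun x => ?_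
    refine avg_bound_aux _ _ (hπe0 x) (hπe1 x) _ fun y => ?_
    calc |f x y| ≤ ∑ y, |f x y| :=
          Finset.single_le_sum (f := fun y => |f x y|) (fun _ _ => abs_nonneg _)
            (Finset.mem_univ y)
      _ ≤ _ := Finset.single_le_sum (f := fun x => ∑ y, |f x y|)
            (fun _ _ => Finset.sum_nonneg fun _ _ => abs_nonneg _) (Finset.mem_univ x)
  have hsum : Summable (fun t : ℕ =>
      |γ ^ (t + 1) * ∑ s' : S, pstep P πe t s a s' *
          ∑ a' : A, πe s' a' * (bellmanC P rbar γ πe q s' a' - q s' a')|) := by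
    obtain ⟨C, hC⟩ := key (fun s' a' => bellmanC P rbar γ πe q s' a' - q s' a')
    refine Summable.of_nonneg_of_le (fun _ => abs_nonneg _) (fun t => ?_)
      ((summable_geometric_of_lt_one hγ0.le hγ1).mul_right (γ * C))
    rw [abs_mul, abs_of_pos (pow_pos hγ0 _), pow_succ, mul_assoc]
    have := hC t
    gcongr
  refine ⟨hsum, ?_⟩
  set u : ℕ → ℝ := fun t => γ ^ (t + 1) *
    ∑ s' : S, pstep P πe t s a s' * ∑ a' : A, πe s' a' * (Q s' a' - q s' a') with hu
  have hu0 : Filter.Tendsto u Filter.atTop (nhds 0) := by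
    obtain ⟨C, hC⟩ := key (fun s' a' => Q s' a' - q s' a')
    have hg : Filter.Tendsto (fun t : ℕ => γ ^ t * (γ * C)) Filter.atTop (nhds 0) := by
      simpa using (tendsto_pow_atTop_nhds_zero_of_lt_one hγ0.le hγ1).mul_const (γ * C)
    refine squeeze_zero_norm (fun t => ?_) hg
    rw [Real.norm_eq_abs, hu]
    simp only
    rw [abs_mul, abs_of_pos (pow_pos hγ0 _), pow_succ, mul_assoc]
    have := hC t
    gcongr
  have hres : ∀ x y, bellmanC P rbar γ πe q x y - q x y
      = (Q x y - q x y)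
        - γ * ∑ z, P x y z * ∑ b, πe z b * (Q z b - q z b) := by
    intro x y
    have h := hQ x y
    simp only [bellmanC] at h ⊢
    simp only [mul_sub, Finset.sum_sub_distrib]
    linarith
  have hterm : ∀ t : ℕ, γ ^ (t + 1) * ∑ s' : S, pstep P πe t s a s' *
      ∑ a' : A, πe s' a' * (bellmanC P rbar γ πe q s' a' - q s' a') = u t - u (t + 1) := by
    intro t
    simp only [hu]
    rw [pstep_succ_sum_aux P πe t s a (fun z => ∑ b, πe z b * (Q z b - q z b)),
      pow_succ γ (t + 1), mul_assoc (γ ^ (t + 1)) γ, ← mul_sub, Finset.mul_sum _ _ γ,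
      ← Finset.sum_sub_distrib]
    congr 1
    refine Finset.sum_congr rfl fun x _ => ?_
    rw [mul_left_comm γ, ← mul_sub, Finset.mul_sum _ _ γ, ← Finset.sum_sub_distrib]
    congr 1
    refine Finset.sum_congr rfl fun y _ => ?_
    rw [hres]
    ring
  have hlim := hsum.of_abs.hasSum.tendsto_sum_nat
  simp only [hterm, Finset.sum_range_sub'] at hlim
  have hlim2 : Filter.Tendsto (fun n => u 0 - u n) Filter.atTop (nhds (u 0)) := by
    simpa using hu0.const_sub (u 0)
  have heq := tendsto_nhds_unique hlim hlim2
  simp only [hterm]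
  rw [heq, hres]
  simp only [hu, pstep]
  ring
end

section
/- Double robustness, correct Q-nuisance: for every nuisance pair b : S×A → (0,∞) and w : S×S×A → ℝ, and every g : S×A → ℝ, L(b, w, Q_{πe}, g) = L(b, w, Q_{πe}, Q_{πe}) + 2·‖g − Q_{πe}‖²_{2,d_b·πe}. In particular, if the Q-nuisance is correctly specified (q = Q_{πe}), then g = Q_{πe} minimizes g ↦ L(b, w, Q_{πe}, g) over all g : S×A → ℝ, regardless of the behavior-policy nuisance b and the density-ratio nuisance w. -/
open Finset

/-- The population loss `L(b,w,q,g)`: for observations `o' = (s',a',r',s̃')` drawn from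
the observational one-step distribution `p_b(o') = d_b(s')·πb(a'|s')·p_r(r'|s',a')·P(s̃'|s',a')`,
`L(b,w,q,g) = E_{o'∼p_b}[ Σ_a πe(a|s')·(φ1(o',a) − g(s',a))² + Σ_{s,a} d_b(s)·πe(a|s)·(φ2(o',s,a) − g(s,a))² ]`
with `φ1(o',a) = 2·𝟙{a'=a}/b(s',a')·δ_q(o') + q(s',a)`,
`φ2(o',s,a) = 2·(πe(a'|s')/b(s',a'))·w(s',s,a)·δ_q(o') + q(s,a)`, and
`δ_q(o') = r' + γ·v_q(s̃') − q(s',a')`, `v_q(s̃) = Σ_ã πe(ã|s̃)·q(s̃,ã)`. -/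
noncomputable def Lloss {S A : Type*} [Fintype S] [Fintype A] [DecidableEq A]
    (R0 : Finset ℝ) (P : S → A → S → ℝ) (pr : S → A → ℝ → ℝ)
    (γ : ℝ) (πb πe : S → A → ℝ) (db : S → ℝ)
    (b : S → A → ℝ) (w : S → S → A → ℝ) (q g : S → A → ℝ) : ℝ :=
  ∑ s' : S, ∑ a' : A, ∑ r' ∈ R0, ∑ st : S,
    db s' * πb s' a' * pr s' a' r' * P s' a' st *
      ((∑ a : A, πe s' a *
          (2 * (if a' = a then (1 : ℝ) else 0) / b s' a' *
              (r' + γ * (∑ a2 : A, πe st a2 * q st a2) - q s' a') + q s' a - g s' a) ^ 2) +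
       (∑ s : S, ∑ a : A, db s * πe s a *
          (2 * (πe s' a' / b s' a') * w s' s a *
              (r' + γ * (∑ a2 : A, πe st a2 * q st a2) - q s' a') + q s a - g s a) ^ 2))

/-- Weighted squared norm `‖f‖²_{2,d_b·πe} = Σ_{s,a} d_b(s)·πe(a|s)·f(s,a)²`. -/
noncomputable def wnormSq {S A : Type*} [Fintype S] [Fintype A]
    (db : S → ℝ) (πe : S → A → ℝ) (f : S → A → ℝ) : ℝ :=
  ∑ s : S, ∑ a : A, db s * πe s a * f s a ^ 2

/-- double robustness with correct Q-nuisance: for arbitrary nuisances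
`b` (positive) and `w`, `L(b,w,Q_{πe},g) = L(b,w,Q_{πe},Q_{πe}) + 2·‖g − Q_{πe}‖²_{2,d_b·πe}`;
in particular `g = Q_{πe}` minimizes `g ↦ L(b,w,Q_{πe},g)`. -/
theorem double_robustness_correct_Q_nuisance
    (S A : Type*) [Fintype S] [Fintype A] [Nonempty S] [Nonempty A] [DecidableEq A]
    (R0 : Finset ℝ)
    (P : S → A → S → ℝ) (hP0 : ∀ s a s', 0 ≤ P s a s')
    (hP1 : ∀ s a, ∑ s' : S, P s a s' = 1)
    (pr : S → A → ℝ → ℝ) (hpr0 : ∀ s a, ∀ r ∈ R0, 0 ≤ pr s a r)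
    (hpr1 : ∀ s a, ∑ r ∈ R0, pr s a r = 1)
    (rbar : S → A → ℝ) (hrbar : ∀ s a, rbar s a = ∑ r ∈ R0, r * pr s a r)
    (γ : ℝ) (hγ0 : 0 < γ) (hγ1 : γ < 1)
    (πb : S → A → ℝ) (hπb0 : ∀ s a, 0 < πb s a) (hπb1 : ∀ s, ∑ a : A, πb s a = 1)
    (πe : S → A → ℝ) (hπe0 : ∀ s a, 0 ≤ πe s a) (hπe1 : ∀ s, ∑ a : A, πe s a = 1)
    (db : S → ℝ) (hdb0 : ∀ s, 0 < db s) (hdb1 : ∑ s : S, db s = 1)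
    (Q : S → A → ℝ)
    (hQ : ∀ s a, Q s a =
      rbar s a + γ * ∑ s' : S, P s a s' * ∑ a' : A, πe s' a' * Q s' a')
    (b : S → A → ℝ) (hb : ∀ s a, 0 < b s a) (w : S → S → A → ℝ) :
    (∀ g : S → A → ℝ,
      Lloss R0 P pr γ πb πe db b w Q g
        = Lloss R0 P pr γ πb πe db b w Q Q
          + 2 * wnormSq db πe (fun s a => g s a - Q s a))
    ∧ (∀ g : S → A → ℝ,
        Lloss R0 P pr γ πb πe db b w Q Q ≤ Lloss R0 P pr γ πb πe db b w Q g) := by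
  have hδ : ∀ s a, ∑ r ∈ R0, ∑ t : S, pr s a r * P s a t *
      (r + γ * (∑ a2 : A, πe t a2 * Q t a2) - Q s a) = 0 := by
    intro s a
    have h1 : ∀ r ∈ R0, ∑ t : S, pr s a r * P s a t *
        (r + γ * (∑ a2 : A, πe t a2 * Q t a2) - Q s a)
        = r * pr s a r + pr s a r * (γ * (∑ t : S, P s a t * ∑ a2 : A, πe t a2 * Q t a2) - Q s a) := by
      intro r _
      have : ∀ t : S, pr s a r * P s a t *
        (r + γ * (∑ a2 : A, πe t a2 * Q t a2) - Q s a)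
        = (pr s a r * (r - Q s a)) * P s a t
          + (pr s a r * γ) * (P s a t * ∑ a2 : A, πe t a2 * Q t a2) := by
        intro t; ring
      rw [Finset.sum_congr rfl (fun t _ => this t), Finset.sum_add_distrib, ← Finset.mul_sum,
        ← Finset.mul_sum, hP1]
      ring
    rw [Finset.sum_congr rfl h1, Finset.sum_add_distrib, ← Finset.sum_mul, hpr1, ← hrbar]
    linarith [hQ s a]
  have hone : ∀ s a, ∑ r ∈ R0, ∑ t : S, pr s a r * P s a t = 1 := by
    intro s a
    simp_rw [← Finset.mul_sum, hP1, mul_one, hpr1]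
  have key : ∀ g : S → A → ℝ,
      Lloss R0 P pr γ πb πe db b w Q g
        = Lloss R0 P pr γ πb πe db b w Q Q
          + 2 * wnormSq db πe (fun s a => g s a - Q s a) := by
    intro g
    set N := wnormSq db πe (fun s a => g s a - Q s a) with hN
    let K : S → ℝ := fun s => ∑ a : A, πe s a * (g s a - Q s a) ^ 2
    let C : S → A → ℝ := fun s' a' =>
      (∑ a : A, πe s' a * (2 * (2 * (if a' = a then (1 : ℝ) else 0) / b s' a') * (Q s' a - g s' a)))
      + ∑ s : S, ∑ a : A, db s * πe s a *
          (2 * (2 * (πe s' a' / b s' a') * w s' s a) * (Q s a - g s a))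
    have hpt : ∀ (s' : S) (a' : A) (d : ℝ),
        ((∑ a : A, πe s' a *
          (2 * (if a' = a then (1 : ℝ) else 0) / b s' a' * d + Q s' a - g s' a) ^ 2) +
        (∑ s : S, ∑ a : A, db s * πe s a *
          (2 * (πe s' a' / b s' a') * w s' s a * d + Q s a - g s a) ^ 2))
        = ((∑ a : A, πe s' a *
          (2 * (if a' = a then (1 : ℝ) else 0) / b s' a' * d + Q s' a - Q s' a) ^ 2) +
        (∑ s : S, ∑ a : A, db s * πe s a *
          (2 * (πe s' a' / b s' a') * w s' s a * d + Q s a - Q s a) ^ 2))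
        + (C s' a' * d + (K s' + N)) := by
      intro s' a' d
      have e1 : (∑ a : A, πe s' a *
          (2 * (if a' = a then (1 : ℝ) else 0) / b s' a' * d + Q s' a - g s' a) ^ 2)
          = (∑ a : A, πe s' a *
          (2 * (if a' = a then (1 : ℝ) else 0) / b s' a' * d + Q s' a - Q s' a) ^ 2)
          + (∑ a : A, πe s' a * (2 * (2 * (if a' = a then (1 : ℝ) else 0) / b s' a')
              * (Q s' a - g s' a))) * d + K s' := by
        simp only [K]
        rw [Finset.sum_mul, ← Finset.sum_add_distrib, ← Finset.sum_add_distrib]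
        refine Finset.sum_congr rfl fun a _ => ?_
        ring
      have e2 : (∑ s : S, ∑ a : A, db s * πe s a *
          (2 * (πe s' a' / b s' a') * w s' s a * d + Q s a - g s a) ^ 2)
          = (∑ s : S, ∑ a : A, db s * πe s a *
          (2 * (πe s' a' / b s' a') * w s' s a * d + Q s a - Q s a) ^ 2)
          + (∑ s : S, ∑ a : A, db s * πe s a *
          (2 * (2 * (πe s' a' / b s' a') * w s' s a) * (Q s a - g s a))) * d + N := by
        rw [hN, wnormSq]
        simp_rw [Finset.sum_mul, ← Finset.sum_add_distrib]
        refine Finset.sum_congr rfl fun s _ => Finset.sum_congr rfl fun a _ => ?_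
        ring
      rw [e1, e2]
      simp only [C]
      ring
    have hin : ∀ s' a', ∑ r ∈ R0, ∑ t : S, db s' * πb s' a' * pr s' a' r * P s' a' t *
        (C s' a' * (r + γ * (∑ a2 : A, πe t a2 * Q t a2) - Q s' a') + (K s' + N))
        = db s' * (K s' + N) * πb s' a' := by
      intro s' a'
      have e : ∀ r ∈ R0, ∀ t ∈ (Finset.univ : Finset S),
        db s' * πb s' a' * pr s' a' r * P s' a' t *
        (C s' a' * (r + γ * (∑ a2 : A, πe t a2 * Q t a2) - Q s' a') + (K s' + N))
        = (db s' * πb s' a' * C s' a') * (pr s' a' r * P s' a' t *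
            (r + γ * (∑ a2 : A, πe t a2 * Q t a2) - Q s' a'))
          + (db s' * (K s' + N) * πb s' a') * (pr s' a' r * P s' a' t) := by
        intro r _ t _; ring
      rw [Finset.sum_congr rfl fun r hr => Finset.sum_congr rfl (e r hr)]
      simp only [Finset.sum_add_distrib, ← Finset.mul_sum]
      simp only [Finset.mul_sum] at hδ ⊢
      simp only [← Finset.mul_sum] at hδ ⊢
      rw [hδ]
      simp only [hP1, mul_one, hpr1]
      ring
    have hK : ∑ s : S, db s * K s = N := by
      rw [hN, wnormSq]
      refine Finset.sum_congr rfl fun s _ => ?_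
      simp only [K, Finset.mul_sum, mul_assoc]
    unfold Lloss
    simp_rw [hpt, mul_add _ _ (C _ _ * _ + (_ + _)), Finset.sum_add_distrib, hin,
      ← Finset.mul_sum, hπb1, mul_one, mul_add, Finset.sum_add_distrib, ← Finset.sum_mul, hdb1, hK]
    ring
  refine ⟨key, fun g => ?_⟩
  rw [key g]
  have : 0 ≤ wnormSq db πe (fun s a => g s a - Q s a) :=
    Finset.sum_nonneg fun s _ => Finset.sum_nonneg fun a _ =>
      mul_nonneg (mul_nonneg (hdb0 s).le (hπe0 s a)) (sq_nonneg _)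
  linarith
end

section
/- Double robustness, correct behavior policy and density ratio: for every q : S×A → ℝ and every g : S×A → ℝ, L(πb, w*, q, g) = L(πb, w*, q, Q_{πe}) + 2·‖g − Q_{πe}‖²_{2,d_b·πe}, where the behavior-policy nuisance b = πb and the density-ratio nuisance w = w* are correctly specified while the Q-nuisance q is arbitrary. In particular, g = Q_{πe} minimizes g ↦ L(πb, w*, q, g) over all g : S×A → ℝ for every q. -/
open Finset

/-- The true discounted stationary density ratio
`w*(s',s,a) = (Σ_{t≥1} γ^t·p_{πe}^t(s'|s,a)) / d_b(s')`. -/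
noncomputable def wstar {S A : Type*} [Fintype S] [Fintype A]
    (P : S → A → S → ℝ) (πe : S → A → ℝ) (γ : ℝ) (db : S → ℝ)
    (s' s : S) (a : A) : ℝ :=
  (∑' t : ℕ, γ ^ (t + 1) * pstep P πe t s a s') / db s'


section helpers
variable {S A : Type*} [Fintype S] [Fintype A]

lemma pstep_nonneg (P : S → A → S → ℝ) (hP0 : ∀ s a s', 0 ≤ P s a s')
    (π : S → A → ℝ) (hπ0 : ∀ s a, 0 ≤ π s a) (t : ℕ) (s : S) (a : A) (s' : S) :
    0 ≤ pstep P π t s a s' := by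
  induction t generalizing s' with
  | zero => exact hP0 s a s'
  | succ t ih =>
    exact Finset.sum_nonneg fun s'' _ => Finset.sum_nonneg fun a'' _ =>
      mul_nonneg (mul_nonneg (ih s'') (hπ0 _ _)) (hP0 _ _ _)

lemma pstep_sum (P : S → A → S → ℝ) (hP1 : ∀ s a, ∑ s' : S, P s a s' = 1)
    (π : S → A → ℝ) (hπ1 : ∀ s, ∑ a : A, π s a = 1) (t : ℕ) (s : S) (a : A) :
    ∑ s' : S, pstep P π t s a s' = 1 := by
  induction t with
  | zero => exact hP1 s a
  | succ t ih =>
    simp only [pstep]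
    rw [Finset.sum_comm]
    rw [← ih]
    refine Finset.sum_congr rfl fun s'' _ => ?_
    rw [Finset.sum_comm]
    simp only [← Finset.mul_sum, hP1, hπ1, mul_one]

lemma pstep_summable (P : S → A → S → ℝ) (hP0 : ∀ s a s', 0 ≤ P s a s')
    (hP1 : ∀ s a, ∑ s' : S, P s a s' = 1)
    (π : S → A → ℝ) (hπ0 : ∀ s a, 0 ≤ π s a) (hπ1 : ∀ s, ∑ a : A, π s a = 1)
    (γ : ℝ) (hγ0 : 0 < γ) (hγ1 : γ < 1) (s : S) (a : A) (s' : S) :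
    Summable fun t : ℕ => γ ^ (t + 1) * pstep P π t s a s' := by
  have hg : Summable fun t : ℕ => γ ^ (t + 1) :=
    (summable_nat_add_iff 1).2 (summable_geometric_of_lt_one hγ0.le hγ1)
  refine Summable.of_nonneg_of_le
    (fun t => mul_nonneg (by positivity) (pstep_nonneg P hP0 π hπ0 t s a s')) (fun t => ?_) hg
  have h1 : pstep P π t s a s' ≤ 1 := by
    rw [← pstep_sum P hP1 π hπ1 t s a]
    exact Finset.single_le_sum (f := fun x => pstep P π t s a x)
      (fun x _ => pstep_nonneg P hP0 π hπ0 t s a x) (Finset.mem_univ s')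
  exact mul_le_of_le_one_right (by positivity) h1

lemma W_rec (P : S → A → S → ℝ) (hP0 : ∀ s a s', 0 ≤ P s a s')
    (hP1 : ∀ s a, ∑ s' : S, P s a s' = 1)
    (π : S → A → ℝ) (hπ0 : ∀ s a, 0 ≤ π s a) (hπ1 : ∀ s, ∑ a : A, π s a = 1)
    (γ : ℝ) (hγ0 : 0 < γ) (hγ1 : γ < 1) (s : S) (a : A) (s' : S) :
    (∑' t : ℕ, γ ^ (t + 1) * pstep P π t s a s') = γ * P s a s' +
      γ * ∑ s'' : S, ∑ a'' : A,
        (∑' t : ℕ, γ ^ (t + 1) * pstep P π t s a s'') * π s'' a'' * P s'' a'' s' := by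
  have hs := pstep_summable P hP0 hP1 π hπ0 hπ1 γ hγ0 hγ1 s a
  rw [(hs s').tsum_eq_zero_add]
  congr 1
  · simp [pstep]
  · have hh : HasSum (fun t : ℕ => γ * ∑ s'' : S, ∑ a'' : A,
        (γ ^ (t + 1) * pstep P π t s a s'') * π s'' a'' * P s'' a'' s')
        (γ * ∑ s'' : S, ∑ a'' : A,
        (∑' t : ℕ, γ ^ (t + 1) * pstep P π t s a s'') * π s'' a'' * P s'' a'' s') :=
      (hasSum_sum fun s'' _ => hasSum_sum fun a'' _ =>
        (((hs s'').hasSum.mul_right _).mul_right _)).mul_left γ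
    rw [← hh.tsum_eq]
    refine tsum_congr fun t => ?_
    simp only [pstep, Finset.mul_sum]
    refine Finset.sum_congr rfl fun s'' _ => Finset.sum_congr rfl fun a'' _ => ?_
    ring

/-- If `W = γP + γWπP` then `Σ W π (e - γPπe) = γ P π e`. -/
lemma W_apply (P : S → A → S → ℝ) (π : S → A → ℝ) (γ : ℝ) (s : S) (a : A) (W : S → ℝ)
    (hW : ∀ s', W s' = γ * P s a s' + γ * ∑ s'' : S, ∑ a'' : A, W s'' * π s'' a'' * P s'' a'' s')
    (e D : S → A → ℝ)
    (hD : ∀ s a, e s a = D s a + γ * ∑ s' : S, P s a s' * ∑ a' : A, π s' a' * e s' a') :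
    ∑ s' : S, ∑ a' : A, W s' * π s' a' * D s' a' = e s a - D s a := by
  set v : S → ℝ := fun s' => ∑ a' : A, π s' a' * e s' a' with hv
  have hD' : ∀ s a, D s a = e s a - γ * ∑ s' : S, P s a s' * v s' := fun s a => by
    rw [hD s a]; ring
  have h1 : ∑ s' : S, W s' * v s' = γ * ∑ s' : S, P s a s' * v s' +
      ∑ s'' : S, ∑ a'' : A, W s'' * π s'' a'' * (γ * ∑ s' : S, P s'' a'' s' * v s') := by
    have : ∀ s', W s' * v s' = γ * (P s a s' * v s') +
        ∑ s'' : S, ∑ a'' : A, W s'' * π s'' a'' * (γ * (P s'' a'' s' * v s')) := fun s' => by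
      conv_lhs => rw [hW s']
      rw [add_mul]
      congr 1
      · ring
      · rw [mul_assoc, Finset.sum_mul, Finset.mul_sum]
        refine Finset.sum_congr rfl fun s'' _ => ?_
        rw [Finset.sum_mul, Finset.mul_sum]
        exact Finset.sum_congr rfl fun a'' _ => by ring
    simp only [this, Finset.sum_add_distrib, Finset.mul_sum]
    congr 1
    rw [Finset.sum_comm]
    refine Finset.sum_congr rfl fun s'' _ => ?_
    rw [Finset.sum_comm]
  have h2 : ∑ s' : S, ∑ a' : A, W s' * π s' a' * D s' a' = ∑ s' : S, W s' * v s' -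
      ∑ s'' : S, ∑ a'' : A, W s'' * π s'' a'' * (γ * ∑ s' : S, P s'' a'' s' * v s') := by
    rw [← Finset.sum_sub_distrib]
    refine Finset.sum_congr rfl fun s' _ => ?_
    rw [hv, Finset.mul_sum, ← Finset.sum_sub_distrib]
    refine Finset.sum_congr rfl fun a' _ => ?_
    rw [hD' s' a']; ring
  rw [h2, h1, hD' s a]; ring

/-- Conditional expectation of an affine function of the temporal difference. -/
lemma cond_exp (R0 : Finset ℝ) (p : S → ℝ) (hp1 : ∑ s' : S, p s' = 1)
    (pr : ℝ → ℝ) (hpr1 : ∑ r ∈ R0, pr r = 1) (γ c x α β : ℝ) (v : S → ℝ) :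
    ∑ r ∈ R0, ∑ st : S, c * pr r * p st * (α * (r + γ * v st - x) + β) =
      c * (α * ((∑ r ∈ R0, r * pr r) + γ * (∑ st : S, p st * v st) - x) + β) := by
  have h : ∀ r, ∑ st : S, c * pr r * p st * (α * (r + γ * v st - x) + β) =
      c * α * (r * pr r) + c * pr r * (α * (γ * (∑ st : S, p st * v st) - x) + β) := fun r => by
    have : ∀ st, c * pr r * p st * (α * (r + γ * v st - x) + β) =
      (c * pr r * (α * (r - x) + β)) * p st + (c * pr r * α * γ) * (p st * v st) :=
      fun st => by ring
    simp only [this, Finset.sum_add_distrib, ← Finset.mul_sum, hp1]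
    ring
  simp only [h, Finset.sum_add_distrib, ← Finset.mul_sum, ← Finset.sum_mul, hpr1]
  ring

lemma integrand_diff [DecidableEq A] (πe q g Q : S → A → ℝ) (db : S → ℝ) (b : ℝ)
    (k : ℝ) (w : S → A → ℝ) (s' : S) (a' : A) (δ : ℝ) :
    ((∑ a : A, πe s' a *
        (2 * (if a' = a then (1 : ℝ) else 0) / b * δ + q s' a - g s' a) ^ 2) +
      (∑ s : S, ∑ a : A, db s * πe s a * (2 * k * w s a * δ + q s a - g s a) ^ 2)) =
    ((∑ a : A, πe s' a *
        (2 * (if a' = a then (1 : ℝ) else 0) / b * δ + q s' a - Q s' a) ^ 2) +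
      (∑ s : S, ∑ a : A, db s * πe s a * (2 * k * w s a * δ + q s a - Q s a) ^ 2)) +
    ((-4 / b * πe s' a' * (g s' a' - Q s' a') +
        ∑ s : S, ∑ a : A, -4 * k * (db s * πe s a * w s a * (g s a - Q s a))) * δ +
      ((∑ a : A, πe s' a * (-2 * (q s' a - Q s' a) * (g s' a - Q s' a) + (g s' a - Q s' a) ^ 2)) +
       ∑ s : S, ∑ a : A, db s * πe s a *
        (-2 * (q s a - Q s a) * (g s a - Q s a) + (g s a - Q s a) ^ 2))) := by
  have h1 : -4 / b * πe s' a' * (g s' a' - Q s' a') = ∑ a : A,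
      -4 / b * (if a' = a then (1 : ℝ) else 0) * πe s' a * (g s' a - Q s' a) := by
    rw [Finset.sum_eq_single a'] <;> simp +contextual [eq_comm]
  have e1 : (∑ a : A, πe s' a *
        (2 * (if a' = a then (1 : ℝ) else 0) / b * δ + q s' a - g s' a) ^ 2) =
      (∑ a : A, πe s' a *
        (2 * (if a' = a then (1 : ℝ) else 0) / b * δ + q s' a - Q s' a) ^ 2) +
      (-4 / b * πe s' a' * (g s' a' - Q s' a')) * δ +
      ∑ a : A, πe s' a *
        (-2 * (q s' a - Q s' a) * (g s' a - Q s' a) + (g s' a - Q s' a) ^ 2) := by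
    rw [h1, Finset.sum_mul, ← Finset.sum_add_distrib, ← Finset.sum_add_distrib]
    exact Finset.sum_congr rfl fun a _ => by ring
  have e2 : (∑ s : S, ∑ a : A, db s * πe s a * (2 * k * w s a * δ + q s a - g s a) ^ 2) =
      (∑ s : S, ∑ a : A, db s * πe s a * (2 * k * w s a * δ + q s a - Q s a) ^ 2) +
      (∑ s : S, ∑ a : A, -4 * k * (db s * πe s a * w s a * (g s a - Q s a))) * δ +
      ∑ s : S, ∑ a : A, db s * πe s a *
        (-2 * (q s a - Q s a) * (g s a - Q s a) + (g s a - Q s a) ^ 2) := by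
    rw [Finset.sum_mul, ← Finset.sum_add_distrib, ← Finset.sum_add_distrib]
    refine Finset.sum_congr rfl fun s _ => ?_
    rw [Finset.sum_mul, ← Finset.sum_add_distrib, ← Finset.sum_add_distrib]
    exact Finset.sum_congr rfl fun a _ => by ring
  rw [e1, e2]; ring

lemma sum_swap4 (f : S → A → S → A → ℝ) :
    ∑ s' : S, ∑ a' : A, ∑ s : S, ∑ a : A, f s' a' s a =
      ∑ s : S, ∑ a : A, ∑ s' : S, ∑ a' : A, f s' a' s a := by
  have h := Finset.sum_comm (s := (Finset.univ : Finset (S × A)))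
    (t := (Finset.univ : Finset (S × A))) (f := fun x y => f x.1 x.2 y.1 y.2)
  simpa only [Fintype.sum_prod_type] using h

end helpers

/-- double robustness with correct behavior policy and density ratio:
for arbitrary Q-nuisance `q`,
`L(πb,w*,q,g) = L(πb,w*,q,Q_{πe}) + 2·‖g − Q_{πe}‖²_{2,d_b·πe}`;
in particular `g = Q_{πe}` minimizes `g ↦ L(πb,w*,q,g)` for every `q`. -/
theorem double_robustness_correct_b_and_w
    (S A : Type*) [Fintype S] [Fintype A] [Nonempty S] [Nonempty A] [DecidableEq A]
    (R0 : Finset ℝ)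
    (P : S → A → S → ℝ) (hP0 : ∀ s a s', 0 ≤ P s a s')
    (hP1 : ∀ s a, ∑ s' : S, P s a s' = 1)
    (pr : S → A → ℝ → ℝ) (hpr0 : ∀ s a, ∀ r ∈ R0, 0 ≤ pr s a r)
    (hpr1 : ∀ s a, ∑ r ∈ R0, pr s a r = 1)
    (rbar : S → A → ℝ) (hrbar : ∀ s a, rbar s a = ∑ r ∈ R0, r * pr s a r)
    (γ : ℝ) (hγ0 : 0 < γ) (hγ1 : γ < 1)
    (πb : S → A → ℝ) (hπb0 : ∀ s a, 0 < πb s a) (hπb1 : ∀ s, ∑ a : A, πb s a = 1)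
    (πe : S → A → ℝ) (hπe0 : ∀ s a, 0 ≤ πe s a) (hπe1 : ∀ s, ∑ a : A, πe s a = 1)
    (db : S → ℝ) (hdb0 : ∀ s, 0 < db s) (hdb1 : ∑ s : S, db s = 1)
    (Q : S → A → ℝ)
    (hQ : ∀ s a, Q s a =
      rbar s a + γ * ∑ s' : S, P s a s' * ∑ a' : A, πe s' a' * Q s' a')
    (q : S → A → ℝ) :
    (∀ g : S → A → ℝ,
      Lloss R0 P pr γ πb πe db πb (wstar P πe γ db) q g
        = Lloss R0 P pr γ πb πe db πb (wstar P πe γ db) q Q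
          + 2 * wnormSq db πe (fun s a => g s a - Q s a))
    ∧ (∀ g : S → A → ℝ,
        Lloss R0 P pr γ πb πe db πb (wstar P πe γ db) q Q
          ≤ Lloss R0 P pr γ πb πe db πb (wstar P πe γ db) q g) := by
  have key : ∀ g : S → A → ℝ,
      Lloss R0 P pr γ πb πe db πb (wstar P πe γ db) q g
        = Lloss R0 P pr γ πb πe db πb (wstar P πe γ db) q Q
          + 2 * wnormSq db πe (fun s a => g s a - Q s a) := by
    intro g
    obtain ⟨D, hDdef⟩ : ∃ D : S → A → ℝ, ∀ s a, D s a = (∑ r ∈ R0, r * pr s a r) +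
        γ * (∑ st : S, P s a st * ∑ a2 : A, πe st a2 * q st a2) - q s a := ⟨_, fun _ _ => rfl⟩
    have hWD : ∀ s a, ∑ s' : S, ∑ a' : A, db s' * wstar P πe γ db s' s a * πe s' a' * D s' a'
        = (Q s a - q s a) - D s a := by
      intro s a
      have hW : ∀ s', db s' * wstar P πe γ db s' s a =
          ∑' t : ℕ, γ ^ (t + 1) * pstep P πe t s a s' := fun s' => by
        unfold wstar
        exact mul_div_cancel₀ _ (hdb0 s').ne'
      refine W_apply P πe γ s a (fun s' => db s' * wstar P πe γ db s' s a) ?_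
        (fun s a => Q s a - q s a) D ?_
      · intro s'
        simp only [hW]
        exact W_rec P hP0 hP1 πe hπe0 hπe1 γ hγ0 hγ1 s a s'
      · intro s a
        simp only [mul_sub, Finset.sum_sub_distrib]
        rw [hDdef, hQ s a, hrbar]
        ring
    obtain ⟨h, hh⟩ : ∃ h : S → A → ℝ, ∀ s a, h s a = g s a - Q s a := ⟨_, fun _ _ => rfl⟩
    obtain ⟨B, hB⟩ : ∃ B : S → ℝ, ∀ s, B s = ∑ a : A, πe s a *
        (-2 * (q s a - Q s a) * h s a + h s a ^ 2) := ⟨_, fun _ => rfl⟩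
    obtain ⟨C, hC⟩ : ∃ C : ℝ, C = ∑ s : S, ∑ a : A, db s * πe s a *
        (-2 * (q s a - Q s a) * h s a + h s a ^ 2) := ⟨_, rfl⟩
    have hBC : ∑ s : S, db s * B s = C := by
      rw [hC]
      refine Finset.sum_congr rfl fun s _ => ?_
      rw [hB, Finset.mul_sum]
      exact Finset.sum_congr rfl fun a _ => by ring
    have hstep : Lloss R0 P pr γ πb πe db πb (wstar P πe γ db) q g
        = Lloss R0 P pr γ πb πe db πb (wstar P πe γ db) q Q +
          ∑ s' : S, ∑ a' : A, db s' * πb s' a' *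
            ((-4 / πb s' a' * πe s' a' * h s' a' +
              ∑ s : S, ∑ a : A, -4 * (πe s' a' / πb s' a') *
                (db s * πe s a * wstar P πe γ db s' s a * h s a)) * D s' a' + (B s' + C)) := by
      unfold Lloss
      rw [← Finset.sum_add_distrib]
      refine Finset.sum_congr rfl fun s' _ => ?_
      rw [← Finset.sum_add_distrib]
      refine Finset.sum_congr rfl fun a' _ => ?_
      rw [hDdef, ← cond_exp R0 (P s' a') (hP1 s' a') (pr s' a') (hpr1 s' a') γ
        (db s' * πb s' a') (q s' a') _ _ (fun st => ∑ a2 : A, πe st a2 * q st a2)]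
      rw [← Finset.sum_add_distrib]
      refine Finset.sum_congr rfl fun r' _ => ?_
      rw [← Finset.sum_add_distrib]
      refine Finset.sum_congr rfl fun st _ => ?_
      rw [integrand_diff πe q g Q db (πb s' a') (πe s' a' / πb s' a')
        (fun s a => wstar P πe γ db s' s a) s' a', hB, hC]
      simp only [hh]
      ring
    rw [hstep]
    congr 1
    have hsplit : ∀ s' a', db s' * πb s' a' *
            ((-4 / πb s' a' * πe s' a' * h s' a' +
              ∑ s : S, ∑ a : A, -4 * (πe s' a' / πb s' a') *
                (db s * πe s a * wstar P πe γ db s' s a * h s a)) * D s' a' + (B s' + C)) =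
        -4 * (db s' * πe s' a' * h s' a' * D s' a') +
        (∑ s : S, ∑ a : A, (-4 * (db s * πe s a * h s a)) *
          (db s' * wstar P πe γ db s' s a * πe s' a' * D s' a')) +
        (db s' * (B s' + C)) * πb s' a' := by
      intro s' a'
      have hb := (hπb0 s' a').ne'
      have : (∑ s : S, ∑ a : A, (-4 * (db s * πe s a * h s a)) *
          (db s' * wstar P πe γ db s' s a * πe s' a' * D s' a')) =
          db s' * πb s' a' * (∑ s : S, ∑ a : A, -4 * (πe s' a' / πb s' a') *
                (db s * πe s a * wstar P πe γ db s' s a * h s a)) * D s' a' := by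
        simp only [Finset.mul_sum, Finset.sum_mul]
        refine Finset.sum_congr rfl fun s _ => Finset.sum_congr rfl fun a _ => ?_
        field_simp
      rw [this]
      field_simp
    simp only [hsplit, Finset.sum_add_distrib]
    have hswap : ∑ s' : S, ∑ a' : A, ∑ s : S, ∑ a : A, (-4 * (db s * πe s a * h s a)) *
          (db s' * wstar P πe γ db s' s a * πe s' a' * D s' a') =
        ∑ s : S, ∑ a : A, (-4 * (db s * πe s a * h s a)) * ((Q s a - q s a) - D s a) := by
      simp only [← hWD, Finset.mul_sum]
      exact sum_swap4 fun s' a' s a => (-4 * (db s * πe s a * h s a)) *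
          (db s' * wstar P πe γ db s' s a * πe s' a' * D s' a')
    rw [hswap]
    have hBπ : ∑ s : S, ∑ a : A, db s * (B s + C) * πb s a = ∑ s : S, db s * (B s + C) := by
      simp only [← Finset.mul_sum, hπb1, mul_one]
    rw [hBπ]
    have hBC2 : ∑ s : S, db s * (B s + C) = 2 * C := by
      simp only [mul_add, Finset.sum_add_distrib, hBC, ← Finset.sum_mul, hdb1]
      ring
    rw [hBC2, hC]
    unfold wnormSq
    simp only [← hh, Finset.mul_sum, ← Finset.sum_add_distrib]
    refine Finset.sum_congr rfl fun s _ => Finset.sum_congr rfl fun a _ => ?_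
    ring
  refine ⟨key, fun g => ?_⟩
  rw [key g]
  have : 0 ≤ wnormSq db πe (fun s a => g s a - Q s a) :=
    Finset.sum_nonneg fun s _ => Finset.sum_nonneg fun a _ =>
      mul_nonneg (mul_nonneg (hdb0 s).le (hπe0 s a)) (sq_nonneg _)
  linarith
end

section
/- Neyman-orthogonality with respect to the behavior-policy nuisance: for every w : S×S×A → ℝ and all directions Δb : S×A → ℝ and Δg : S×A → ℝ, the mixed second partial derivative ∂²/∂u∂t of the map (u,t) ↦ L(πb + u·Δb, w, Q_{πe}, Q_{πe} + t·Δg), evaluated at (u,t) = (0,0), equals 0. (Since πb(a|s) > 0 for all (s,a) and S, A are finite, πb + u·Δb is positive for all u in a neighborhood of 0, so the map is well-defined and smooth near (0,0).) -/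
open Finset

/-- Conditional mean of the temporal-difference error at the fixed point is zero. -/
lemma td_mean_zero {S A : Type*} [Fintype S] [Fintype A]
    (R0 : Finset ℝ) (p : S → ℝ) (hP1 : ∑ s' : S, p s' = 1)
    (pr : ℝ → ℝ) (hpr1 : ∑ r ∈ R0, pr r = 1) (γ q : ℝ) (v : S → ℝ)
    (hq : q = ∑ r ∈ R0, r * pr r + γ * ∑ s' : S, p s' * v s') :
    ∑ r ∈ R0, ∑ st : S, pr r * p st * (r + γ * v st - q) = 0 := by
  have h1 : ∀ r ∈ R0, ∑ st : S, pr r * p st * (r + γ * v st - q)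
      = r * pr r + pr r * (γ * (∑ st : S, p st * v st) - q) := by
    intro r _
    have : ∀ st : S, pr r * p st * (r + γ * v st - q)
        = (r * pr r - q * pr r) * p st + pr r * γ * (p st * v st) := fun st => by ring
    simp only [this, Finset.sum_add_distrib, ← Finset.mul_sum, hP1]
    ring
  rw [Finset.sum_congr rfl h1, Finset.sum_add_distrib, ← Finset.sum_mul, hpr1]
  linarith

lemma sq_hasDeriv (k c q d : ℝ) :
    HasDerivAt (fun t : ℝ => k * (c + q - (q + t * d)) ^ 2) (k * (-2 * c * d)) 0 := by
  have h : HasDerivAt (fun t : ℝ => c + q - (q + t * d)) (-d) 0 := by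
    simpa using (((hasDerivAt_id (0 : ℝ)).mul_const d).const_add q).const_sub (c + q)
  refine ((h.fun_pow 2).const_mul k).congr_deriv ?_
  norm_num

/-- Neyman-orthogonality w.r.t. the behavior-policy nuisance:
the mixed second partial derivative `∂²/∂u∂t` at `(0,0)` of
`(u,t) ↦ L(πb + u·Δb, w, Q_{πe}, Q_{πe} + t·Δg)` equals `0`. -/
theorem neyman_orthogonality_behavior_policy
    (S A : Type*) [Fintype S] [Fintype A] [Nonempty S] [Nonempty A] [DecidableEq A]
    (R0 : Finset ℝ)
    (P : S → A → S → ℝ) (hP0 : ∀ s a s', 0 ≤ P s a s')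
    (hP1 : ∀ s a, ∑ s' : S, P s a s' = 1)
    (pr : S → A → ℝ → ℝ) (hpr0 : ∀ s a, ∀ r ∈ R0, 0 ≤ pr s a r)
    (hpr1 : ∀ s a, ∑ r ∈ R0, pr s a r = 1)
    (rbar : S → A → ℝ) (hrbar : ∀ s a, rbar s a = ∑ r ∈ R0, r * pr s a r)
    (γ : ℝ) (hγ0 : 0 < γ) (hγ1 : γ < 1)
    (πb : S → A → ℝ) (hπb0 : ∀ s a, 0 < πb s a) (hπb1 : ∀ s, ∑ a : A, πb s a = 1)
    (πe : S → A → ℝ) (hπe0 : ∀ s a, 0 ≤ πe s a) (hπe1 : ∀ s, ∑ a : A, πe s a = 1)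
    (db : S → ℝ) (hdb0 : ∀ s, 0 < db s) (hdb1 : ∑ s : S, db s = 1)
    (Q : S → A → ℝ)
    (hQ : ∀ s a, Q s a =
      rbar s a + γ * ∑ s' : S, P s a s' * ∑ a' : A, πe s' a' * Q s' a')
    (w : S → S → A → ℝ) (Δb : S → A → ℝ) (Δg : S → A → ℝ) :
    deriv (fun u : ℝ =>
      deriv (fun t : ℝ =>
        Lloss R0 P pr γ πb πe db
          (fun s a => πb s a + u * Δb s a) w Q
          (fun s a => Q s a + t * Δg s a)) 0) 0 = 0 := by
  have key : ∀ b : S → A → ℝ, deriv (fun t : ℝ => Lloss R0 P pr γ πb πe db b w Q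
      (fun s a => Q s a + t * Δg s a)) 0 = 0 := by
    intro b
    unfold Lloss
    refine HasDerivAt.deriv ?_
    have hd := HasDerivAt.fun_sum (u := (Finset.univ : Finset S)) (fun s' _ =>
      HasDerivAt.fun_sum (u := (Finset.univ : Finset A)) (fun a' _ =>
      HasDerivAt.fun_sum (u := R0) (fun r' _ =>
      HasDerivAt.fun_sum (u := (Finset.univ : Finset S)) (fun st _ =>
      HasDerivAt.const_mul (db s' * πb s' a' * pr s' a' r' * P s' a' st)
      (HasDerivAt.fun_add
        (HasDerivAt.fun_sum (u := (Finset.univ : Finset A)) (fun a _ =>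
          sq_hasDeriv (πe s' a) (2 * (if a' = a then (1 : ℝ) else 0) / b s' a' *
              (r' + γ * (∑ a2 : A, πe st a2 * Q st a2) - Q s' a')) (Q s' a) (Δg s' a)))
        (HasDerivAt.fun_sum (u := (Finset.univ : Finset S)) (fun s _ =>
          HasDerivAt.fun_sum (u := (Finset.univ : Finset A)) (fun a _ =>
          sq_hasDeriv (db s * πe s a) (2 * (πe s' a' / b s' a') * w s' s a *
              (r' + γ * (∑ a2 : A, πe st a2 * Q st a2) - Q s' a'))
              (Q s a) (Δg s a)))))))))
    refine hd.congr_deriv ?_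
    refine Finset.sum_eq_zero fun s' _ => Finset.sum_eq_zero fun a' _ => ?_
    have hz := td_mean_zero (A := A) R0 (P s' a') (hP1 s' a') (pr s' a') (hpr1 s' a') γ (Q s' a')
      (fun st => ∑ a2 : A, πe st a2 * Q st a2) (by rw [← hrbar]; exact hQ s' a')
    have hz' := congrArg (fun x => (db s' * πb s' a' *
      ((∑ a : A, πe s' a * (-2 * (2 * (if a' = a then (1 : ℝ) else 0) / b s' a') * Δg s' a)) +
       ∑ s : S, ∑ a : A, db s * πe s a *
        (-2 * (2 * (πe s' a' / b s' a') * w s' s a) * Δg s a))) * x) hz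
    simp only [mul_zero] at hz'
    refine Eq.trans ?_ hz'
    rw [Finset.mul_sum]
    refine Finset.sum_congr rfl fun r _ => ?_
    rw [Finset.mul_sum]
    refine Finset.sum_congr rfl fun st _ => ?_
    generalize (r + γ * (∑ a2 : A, πe st a2 * Q st a2) - Q s' a') = δ
    have e1 : (∑ a : A, πe s' a * (-2 * (2 * (if a' = a then (1 : ℝ) else 0) / b s' a' * δ) * Δg s' a))
        = (∑ a : A, πe s' a * (-2 * (2 * (if a' = a then (1 : ℝ) else 0) / b s' a') * Δg s' a)) * δ := by
      rw [Finset.sum_mul]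
      exact Finset.sum_congr rfl fun a _ => by ring
    have e2 : (∑ s : S, ∑ a : A, db s * πe s a *
        (-2 * (2 * (πe s' a' / b s' a') * w s' s a * δ) * Δg s a))
        = (∑ s : S, ∑ a : A, db s * πe s a *
        (-2 * (2 * (πe s' a' / b s' a') * w s' s a) * Δg s a)) * δ := by
      rw [Finset.sum_mul]
      refine Finset.sum_congr rfl fun s _ => ?_
      rw [Finset.sum_mul]
      exact Finset.sum_congr rfl fun a _ => by ring
    rw [e1, e2]
    ring
  simp only [key, deriv_const]
end

section
/- Neyman-orthogonality with respect to the density-ratio nuisance: for every w : S×S×A → ℝ and all directions Δw : S×S×A → ℝ and Δg : S×A → ℝ, the mixed second partial derivative ∂²/∂u∂t of the map (u,t) ↦ L(πb, w + u·Δw, Q_{πe}, Q_{πe} + t·Δg), evaluated at (u,t) = (0,0), equals 0. -/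
open Finset

/-- Neyman-orthogonality w.r.t. the density-ratio nuisance:
the mixed second partial derivative `∂²/∂u∂t` at `(0,0)` of
`(u,t) ↦ L(πb, w + u·Δw, Q_{πe}, Q_{πe} + t·Δg)` equals `0`. -/
theorem neyman_orthogonality_density_ratio
    (S A : Type*) [Fintype S] [Fintype A] [Nonempty S] [Nonempty A] [DecidableEq A]
    (R0 : Finset ℝ)
    (P : S → A → S → ℝ) (hP0 : ∀ s a s', 0 ≤ P s a s')
    (hP1 : ∀ s a, ∑ s' : S, P s a s' = 1)
    (pr : S → A → ℝ → ℝ) (hpr0 : ∀ s a, ∀ r ∈ R0, 0 ≤ pr s a r)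
    (hpr1 : ∀ s a, ∑ r ∈ R0, pr s a r = 1)
    (rbar : S → A → ℝ) (hrbar : ∀ s a, rbar s a = ∑ r ∈ R0, r * pr s a r)
    (γ : ℝ) (hγ0 : 0 < γ) (hγ1 : γ < 1)
    (πb : S → A → ℝ) (hπb0 : ∀ s a, 0 < πb s a) (hπb1 : ∀ s, ∑ a : A, πb s a = 1)
    (πe : S → A → ℝ) (hπe0 : ∀ s a, 0 ≤ πe s a) (hπe1 : ∀ s, ∑ a : A, πe s a = 1)
    (db : S → ℝ) (hdb0 : ∀ s, 0 < db s) (hdb1 : ∑ s : S, db s = 1)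
    (Q : S → A → ℝ)
    (hQ : ∀ s a, Q s a =
      rbar s a + γ * ∑ s' : S, P s a s' * ∑ a' : A, πe s' a' * Q s' a')
    (w : S → S → A → ℝ) (Δw : S → S → A → ℝ) (Δg : S → A → ℝ) :
    deriv (fun u : ℝ =>
      deriv (fun t : ℝ =>
        Lloss R0 P pr γ πb πe db πb
          (fun s' s a => w s' s a + u * Δw s' s a) Q
          (fun s a => Q s a + t * Δg s a)) 0) 0 = 0 := by
  -- the temporal-difference error is conditionally centred at `Q`
  have hδ : ∀ s' a', ∑ r' ∈ R0, ∑ st : S, pr s' a' r' * P s' a' st *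
      (r' + γ * (∑ a2 : A, πe st a2 * Q st a2) - Q s' a') = 0 := by
    intro s' a'
    have h1 : ∀ r' ∈ R0, ∑ st : S, pr s' a' r' * P s' a' st *
        (r' + γ * (∑ a2 : A, πe st a2 * Q st a2) - Q s' a') =
        r' * pr s' a' r' + pr s' a' r' *
          (γ * (∑ st : S, P s' a' st * ∑ a2 : A, πe st a2 * Q st a2) - Q s' a') := by
      intro r' _
      have h2 : ∀ st : S, pr s' a' r' * P s' a' st *
          (r' + γ * (∑ a2 : A, πe st a2 * Q st a2) - Q s' a') =
          (pr s' a' r' * (r' - Q s' a')) * P s' a' st +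
          (pr s' a' r' * γ) * (P s' a' st * ∑ a2 : A, πe st a2 * Q st a2) := by
        intro st; ring
      rw [Finset.sum_congr rfl fun st _ => h2 st, Finset.sum_add_distrib,
        ← Finset.mul_sum, ← Finset.mul_sum, hP1]
      ring
    rw [Finset.sum_congr rfl h1, Finset.sum_add_distrib, ← Finset.sum_mul, hpr1,
      ← hrbar]
    have := hQ s' a'
    linarith
  -- the loss splits additively in `u` and `t`
  have key : ∀ u t : ℝ,
      Lloss R0 P pr γ πb πe db πb (fun s' s a => w s' s a + u * Δw s' s a) Q
          (fun s a => Q s a + t * Δg s a) =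
      Lloss R0 P pr γ πb πe db πb w Q (fun s a => Q s a + t * Δg s a) +
        (Lloss R0 P pr γ πb πe db πb (fun s' s a => w s' s a + u * Δw s' s a) Q Q -
          Lloss R0 P pr γ πb πe db πb w Q Q) := by
    intro u t
    rw [← sub_eq_zero]
    unfold Lloss
    simp only [← Finset.sum_sub_distrib, ← Finset.sum_add_distrib]
    refine Finset.sum_eq_zero fun s' _ => ?_
    refine Finset.sum_eq_zero fun a' _ => ?_
    obtain ⟨M, hM⟩ : ∃ M : ℝ, M = ∑ s : S, ∑ a : A, db s * πe s a *
      (-2 * t * Δg s a * (2 * (πe s' a' / πb s' a') * (u * Δw s' s a))) := ⟨_, rfl⟩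
    have h := congrArg (fun x => (db s' * πb s' a' * M) * x) (hδ s' a')
    simp only [mul_zero] at h
    rw [← h]
    conv_rhs => rw [Finset.mul_sum]
    refine Finset.sum_congr rfl fun r' _ => ?_
    conv_rhs => rw [Finset.mul_sum]
    refine Finset.sum_congr rfl fun st _ => ?_
    generalize (r' + γ * (∑ a2 : A, πe st a2 * Q st a2) - Q s' a') = δ
    have h3 : ∀ X1 Y1 X2 Y2 Y3 Y4 W : ℝ, W * (X1 + Y1) - (W * (X1 + Y2) +
        (W * (X2 + Y3) - W * (X2 + Y4))) = W * (Y1 - (Y2 + (Y3 - Y4))) := by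
      intros; ring
    rw [h3]
    simp only [← Finset.sum_sub_distrib, ← Finset.sum_add_distrib]
    rw [show db s' * πb s' a' * M * (pr s' a' r' * P s' a' st * δ) =
      db s' * πb s' a' * pr s' a' r' * P s' a' st * (M * δ) by ring]
    congr 1
    rw [hM]
    simp only [Finset.sum_mul]
    refine Finset.sum_congr rfl fun s _ => ?_
    refine Finset.sum_congr rfl fun a _ => ?_
    ring
  have hconst : ∀ u : ℝ, deriv (fun t : ℝ =>
        Lloss R0 P pr γ πb πe db πb
          (fun s' s a => w s' s a + u * Δw s' s a) Q
          (fun s a => Q s a + t * Δg s a)) 0 =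
      deriv (fun t : ℝ =>
        Lloss R0 P pr γ πb πe db πb w Q (fun s a => Q s a + t * Δg s a)) 0 := by
    intro u
    simp only [key u]
    rw [deriv_add_const]
  simp only [hconst, deriv_const]
end

section
/- Quasi-oracle efficiency (finite-setting version): for every B ≥ 1 there exists a constant C > 0, depending only on the MDP (S, A, P, p_r, γ), the policies πb and πe, the distribution d_b, and B, such that for all nuisance estimates b : S×A → (0,∞) with 1/B ≤ b(s,a) ≤ B for all (s,a), w : S×S×A → ℝ with |w(s',s,a)| ≤ B for all (s',s,a), and q : S×A → ℝ with |q(s,a)| ≤ B for all (s,a), and for every ĝ minimizing g ↦ L(b,w,q,g) over all functions g : S×A → ℝ, one has ‖ĝ − Q_{πe}‖²_{2,d_b·πe} ≤ C·( ‖b − πb‖_∞⁴ + ‖b − πb‖_∞²·‖q − Q_{πe}‖_∞² + ‖b − πb‖_∞²·‖w − w*‖_∞² + ‖w − w*‖_∞²·‖q − Q_{πe}‖_∞² ), where ‖·‖_∞ denotes the maximum of the absolute value over all arguments. In particular, the excess error of ĝ is controlled only by products of nuisance estimation errors. -/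
open Finset

section helpers
variable {S A : Type*} [Fintype S] [Fintype A]

lemma aux_pstep_nonneg (P : S → A → S → ℝ) (hP0 : ∀ s a s', 0 ≤ P s a s')
    (π : S → A → ℝ) (hπ : ∀ s a, 0 ≤ π s a) (t : ℕ) : ∀ s a s', 0 ≤ pstep P π t s a s' := by
  induction t with
  | zero => exact hP0
  | succ t ih =>
    intro s a s'
    exact Finset.sum_nonneg fun x _ => Finset.sum_nonneg fun y _ =>
      mul_nonneg (mul_nonneg (ih _ _ _) (hπ _ _)) (hP0 _ _ _)

lemma aux_pstep_apply (P : S → A → S → ℝ) (π : S → A → ℝ) (t : ℕ) (s : S) (a : A) (v : S → ℝ) :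
    ∑ s', pstep P π (t + 1) s a s' * v s'
      = ∑ x, pstep P π t s a x * ∑ y, π x y * ∑ s', P x y s' * v s' := by
  simp only [pstep, Finset.sum_mul, Finset.mul_sum]
  rw [Finset.sum_comm]
  refine Finset.sum_congr rfl fun x _ => ?_
  rw [Finset.sum_comm]
  refine Finset.sum_congr rfl fun y _ => Finset.sum_congr rfl fun z _ => ?_
  ring

lemma aux_pstep_sum (P : S → A → S → ℝ) (hP1 : ∀ s a, ∑ s' : S, P s a s' = 1)
    (π : S → A → ℝ) (hπ1 : ∀ s, ∑ a : A, π s a = 1) (t : ℕ) (s : S) (a : A) :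
    ∑ s', pstep P π t s a s' = 1 := by
  induction t with
  | zero => exact hP1 s a
  | succ t ih =>
    have := aux_pstep_apply P π t s a (fun _ => 1)
    simpa [hP1, hπ1, ih] using this

lemma aux_summable (P : S → A → S → ℝ) (hP0 : ∀ s a s', 0 ≤ P s a s')
    (hP1 : ∀ s a, ∑ s' : S, P s a s' = 1)
    (π : S → A → ℝ) (hπ : ∀ s a, 0 ≤ π s a) (hπ1 : ∀ s, ∑ a : A, π s a = 1)
    (γ : ℝ) (hγ0 : 0 < γ) (hγ1 : γ < 1) (s : S) (a : A) (s' : S) :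
    Summable fun t : ℕ => γ ^ (t + 1) * pstep P π t s a s' := by
  refine Summable.of_nonneg_of_le (fun t => mul_nonneg (by positivity)
    (aux_pstep_nonneg P hP0 π hπ t s a s')) (fun t => ?_)
    (summable_geometric_of_lt_one hγ0.le hγ1)
  have h1 : pstep P π t s a s' ≤ 1 := by
    rw [← aux_pstep_sum P hP1 π hπ1 t s a]
    exact Finset.single_le_sum (f := fun z => pstep P π t s a z)
      (fun z _ => aux_pstep_nonneg P hP0 π hπ t s a z) (Finset.mem_univ s')
  have h2 : γ ^ (t + 1) ≤ γ ^ t := pow_le_pow_of_le_one hγ0.le hγ1.le (Nat.le_succ t)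
  have h3 : 0 < γ ^ (t + 1) := by positivity
  nlinarith

/-- Discounted occupancy identity. -/
lemma aux_occ (P : S → A → S → ℝ) (hP0 : ∀ s a s', 0 ≤ P s a s')
    (hP1 : ∀ s a, ∑ s' : S, P s a s' = 1)
    (π : S → A → ℝ) (hπ : ∀ s a, 0 ≤ π s a) (hπ1 : ∀ s, ∑ a : A, π s a = 1)
    (γ : ℝ) (hγ0 : 0 < γ) (hγ1 : γ < 1) (db : S → ℝ) (hdb0 : ∀ s, 0 < db s) (v : S → ℝ)
    (s : S) (a : A) :
    ∑ x, db x * wstar P π γ db x s a * (v x - γ * ∑ y, π x y * ∑ z, P x y z * v z)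
      = γ * ∑ x, P s a x * v x := by
  have hs := aux_summable P hP0 hP1 π hπ hπ1 γ hγ0 hγ1 s a
  have hw : ∀ x, HasSum (fun t : ℕ => γ ^ (t + 1) * pstep P π t s a x)
      (db x * wstar P π γ db x s a) := by
    intro x
    have : db x * wstar P π γ db x s a = ∑' t : ℕ, γ ^ (t + 1) * pstep P π t s a x := by
      unfold wstar
      rw [mul_div_cancel₀ _ (hdb0 x).ne']
    rw [this]
    exact (hs x).hasSum
  set X : ℕ → ℝ := fun t => ∑ x, γ ^ (t + 1) * pstep P π t s a x * v x with hX
  have hsum := hasSum_sum (s := Finset.univ) fun x _ =>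
    (hw x).mul_right (v x - γ * ∑ y, π x y * ∑ z, P x y z * v z)
  have hterm : ∀ t, ∑ x, γ ^ (t + 1) * pstep P π t s a x *
      (v x - γ * ∑ y, π x y * ∑ z, P x y z * v z) = X t - X (t + 1) := by
    intro t
    have h2 : X (t + 1) = γ ^ (t + 2) *
        ∑ x, pstep P π t s a x * ∑ y, π x y * ∑ s', P x y s' * v s' := by
      rw [← aux_pstep_apply, hX, Finset.mul_sum]
      exact Finset.sum_congr rfl fun x _ => by ring
    rw [h2, hX, Finset.mul_sum, ← Finset.sum_sub_distrib]
    exact Finset.sum_congr rfl fun x _ => by ring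
  simp only [hterm] at hsum
  have hX0 : Filter.Tendsto X Filter.atTop (nhds 0) := by
    have := tendsto_finsetSum (Finset.univ : Finset S) fun x _ =>
      ((hs x).tendsto_atTop_zero).mul_const (v x)
    simpa using this
  have ht := hsum.tendsto_sum_nat
  simp only [Finset.sum_range_sub'] at ht
  have ht2 : Filter.Tendsto (fun n => X 0 - X n) Filter.atTop (nhds (X 0 - 0)) :=
    tendsto_const_nhds.sub hX0
  rw [tendsto_nhds_unique ht ht2, sub_zero, hX, Finset.mul_sum]
  exact Finset.sum_congr rfl fun x _ => by simp [pstep]; ring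

lemma aux_inner (R0 : Finset ℝ) (p : S → ℝ) (hp : ∑ s, p s = 1) (ρ : ℝ → ℝ)
    (hρ : ∑ r ∈ R0, ρ r = 1) (γ c α β q0 : ℝ) (v : S → ℝ) :
    ∑ r ∈ R0, ∑ st, c * ρ r * p st * (α + β * (r + γ * v st - q0))
      = c * (α + β * ((∑ r ∈ R0, r * ρ r) + γ * (∑ st, p st * v st) - q0)) := by
  have h1 : ∀ r, ∑ st, c * ρ r * p st * (α + β * (r + γ * v st - q0))
      = c * (α - β * q0 + β * (γ * ∑ st, p st * v st)) * ρ r + c * β * (r * ρ r) := by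
    intro r
    calc _ = ∑ st, (c * ρ r * (α + β * r - β * q0) * p st
              + c * ρ r * β * γ * (p st * v st)) :=
            Finset.sum_congr rfl fun x _ => by ring
      _ = _ := by
        rw [Finset.sum_add_distrib, ← Finset.mul_sum, ← Finset.mul_sum, hp]; ring
  simp only [h1]
  rw [Finset.sum_add_distrib, ← Finset.mul_sum, ← Finset.mul_sum, hρ]; ring

lemma aux_loss [DecidableEq A] (R0 : Finset ℝ)
    (P : S → A → S → ℝ) (hP1 : ∀ s a, ∑ s' : S, P s a s' = 1)
    (pr : S → A → ℝ → ℝ) (hpr1 : ∀ s a, ∑ r ∈ R0, pr s a r = 1)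
    (γ : ℝ) (πb : S → A → ℝ) (hπb1 : ∀ s, ∑ a : A, πb s a = 1)
    (πe : S → A → ℝ) (db : S → ℝ) (hdb1 : ∑ s : S, db s = 1)
    (b : S → A → ℝ) (w : S → S → A → ℝ) (q g h D : S → A → ℝ)
    (hD : ∀ s a, D s a = (∑ r ∈ R0, r * pr s a r)
      + γ * (∑ st, P s a st * ∑ a2, πe st a2 * q st a2) - q s a)
    (hh : ∀ s a, h s a = q s a + πb s a / b s a * D s a
      + ∑ x, ∑ y, db x * πb x y * (πe x y / b x y * w x s a * D x y)) :
    Lloss R0 P pr γ πb πe db b w q g - Lloss R0 P pr γ πb πe db b w q h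
      = 2 * wnormSq db πe (fun s a => g s a - h s a) := by
  unfold Lloss wnormSq
  simp only [← Finset.sum_sub_distrib, ← mul_sub]
  have e1 : ∀ s' a', (∑ r' ∈ R0, ∑ st : S, db s' * πb s' a' * pr s' a' r' * P s' a' st *
      ((∑ a : A, πe s' a *
          (2 * (if a' = a then (1 : ℝ) else 0) / b s' a' *
              (r' + γ * (∑ a2 : A, πe st a2 * q st a2) - q s' a') + q s' a - g s' a) ^ 2) +
       (∑ s : S, ∑ a : A, db s * πe s a *
          (2 * (πe s' a' / b s' a') * w s' s a *
              (r' + γ * (∑ a2 : A, πe st a2 * q st a2) - q s' a') + q s a - g s a) ^ 2) -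
      ((∑ a : A, πe s' a *
          (2 * (if a' = a then (1 : ℝ) else 0) / b s' a' *
              (r' + γ * (∑ a2 : A, πe st a2 * q st a2) - q s' a') + q s' a - h s' a) ^ 2) +
       (∑ s : S, ∑ a : A, db s * πe s a *
          (2 * (πe s' a' / b s' a') * w s' s a *
              (r' + γ * (∑ a2 : A, πe st a2 * q st a2) - q s' a') + q s a - h s a) ^ 2))))
      = db s' * πb s' a' * (((∑ a : A, πe s' a * ((h s' a - g s' a) *
            (2 * q s' a - g s' a - h s' a)))
          + ∑ s, ∑ a, db s * πe s a * ((h s a - g s a) * (2 * q s a - g s a - h s a)))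
        + ((∑ a : A, πe s' a * ((h s' a - g s' a) *
            (4 * (if a' = a then (1 : ℝ) else 0) / b s' a')))
          + ∑ s, ∑ a, db s * πe s a * ((h s a - g s a) * (4 * (πe s' a' / b s' a') * w s' s a)))
          * D s' a') := by
    intro s' a'
    rw [hD, ← aux_inner R0 (P s' a') (hP1 s' a') (pr s' a') (hpr1 s' a')]
    refine Finset.sum_congr rfl fun r _ => Finset.sum_congr rfl fun st _ => ?_
    congr 1
    generalize (r + γ * (∑ a2 : A, πe st a2 * q st a2) - q s' a') = δ
    rw [add_sub_add_comm, add_mul, add_add_add_comm]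
    simp only [← Finset.sum_sub_distrib, Finset.sum_mul, ← Finset.sum_add_distrib]
    congr 1
    · exact Finset.sum_congr rfl fun a _ => by ring
    · exact Finset.sum_congr rfl fun s _ => Finset.sum_congr rfl fun a _ => by ring
  simp only [e1]
  have e2 : ∀ s', (∑ a', db s' * πb s' a' * (((∑ a : A, πe s' a * ((h s' a - g s' a) *
            (2 * q s' a - g s' a - h s' a)))
          + ∑ s, ∑ a, db s * πe s a * ((h s a - g s a) * (2 * q s a - g s a - h s a)))
        + ((∑ a : A, πe s' a * ((h s' a - g s' a) *
            (4 * (if a' = a then (1 : ℝ) else 0) / b s' a')))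
          + ∑ s, ∑ a, db s * πe s a * ((h s a - g s a) * (4 * (πe s' a' / b s' a') * w s' s a)))
          * D s' a'))
      = (∑ a, db s' * πe s' a * ((h s' a - g s' a) *
          (2 * q s' a - g s' a - h s' a + 4 * (πb s' a / b s' a * D s' a))))
        + db s' * (∑ s, ∑ a, db s * πe s a * ((h s a - g s a) * (2 * q s a - g s a - h s a)))
        + ∑ a', ∑ s, ∑ a, db s * πe s a * ((h s a - g s a) *
            (4 * (db s' * πb s' a' * (πe s' a' / b s' a' * w s' s a * D s' a')))) := by
    intro s'
    generalize (∑ s, ∑ a, db s * πe s a * ((h s a - g s a) * (2 * q s a - g s a - h s a))) = K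
    have e3 : ∀ a', (∑ a : A, πe s' a * ((h s' a - g s' a) *
            (4 * (if a' = a then (1 : ℝ) else 0) / b s' a')))
        = πe s' a' * ((h s' a' - g s' a') * (4 / b s' a')) := by
      intro a'
      rw [Finset.sum_eq_single a']
      · simp
      · intro y _ hy
        simp [Ne.symm hy]
      · simp
    simp only [e3]
    have e4 : ∀ a', ∑ s, ∑ a, db s * πe s a * ((h s a - g s a) *
            (4 * (db s' * πb s' a' * (πe s' a' / b s' a' * w s' s a * D s' a'))))
        = db s' * πb s' a' * D s' a' * ∑ s, ∑ a, db s * πe s a *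
            ((h s a - g s a) * (4 * (πe s' a' / b s' a') * w s' s a)) := by
      intro a'
      simp only [Finset.mul_sum]
      exact Finset.sum_congr rfl fun s _ => Finset.sum_congr rfl fun a _ => by ring
    simp only [e4]
    generalize hG : (fun a' => ∑ s, ∑ a, db s * πe s a *
            ((h s a - g s a) * (4 * (πe s' a' / b s' a') * w s' s a))) = G
    have hG' : ∀ a', (∑ s, ∑ a, db s * πe s a *
            ((h s a - g s a) * (4 * (πe s' a' / b s' a') * w s' s a))) = G a' :=
      fun a' => congrFun hG a'
    simp only [hG']
    generalize hM : (∑ a : A, πe s' a * ((h s' a - g s' a) *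
            (2 * q s' a - g s' a - h s' a))) = M
    have l : ∀ a', db s' * πb s' a' * (M + K +
        (πe s' a' * ((h s' a' - g s' a') * (4 / b s' a')) + G a') * D s' a')
        = db s' * (M + K) * πb s' a' + db s' * πe s' a' * ((h s' a' - g s' a') *
          (4 * (πb s' a' / b s' a' * D s' a'))) + db s' * πb s' a' * D s' a' * G a' := by
      intro a'; ring
    simp only [l, Finset.sum_add_distrib, ← Finset.mul_sum, hπb1]
    have l2 : ∑ a, db s' * πe s' a * ((h s' a - g s' a) *
          (2 * q s' a - g s' a - h s' a + 4 * (πb s' a / b s' a * D s' a)))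
        = db s' * M + ∑ a, db s' * πe s' a * ((h s' a - g s' a) *
          (4 * (πb s' a / b s' a * D s' a))) := by
      rw [← hM, Finset.mul_sum, ← Finset.sum_add_distrib]
      exact Finset.sum_congr rfl fun a _ => by ring
    rw [l2]; ring
  simp only [e2, Finset.sum_add_distrib, ← Finset.sum_mul, hdb1]
  have e5 : (∑ x, ∑ a', ∑ s, ∑ a, db s * πe s a * ((h s a - g s a) *
            (4 * (db x * πb x a' * (πe x a' / b x a' * w x s a * D x a')))))
      = ∑ s, ∑ a, db s * πe s a * ((h s a - g s a) * (4 *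
        ∑ x, ∑ y, db x * πb x y * (πe x y / b x y * w x s a * D x y))) := by
    simp only [Finset.mul_sum]
    refine (Finset.sum_congr rfl fun x _ => Finset.sum_comm).trans ?_
    refine Finset.sum_comm.trans (Finset.sum_congr rfl fun s _ => ?_)
    exact (Finset.sum_congr rfl fun x _ => Finset.sum_comm).trans Finset.sum_comm
  rw [e5]
  simp only [← Finset.sum_add_distrib, Finset.mul_sum, one_mul]
  refine Finset.sum_congr rfl fun s _ => Finset.sum_congr rfl fun a _ => ?_
  simp only [← Finset.mul_sum]
  have := hh s a
  rw [← sub_eq_iff_eq_add'] at this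
  rw [← this]
  ring

lemma aux_avg (p : S → ℝ) (hp0 : ∀ s, 0 ≤ p s) (hp : ∑ s, p s = 1) (f : S → ℝ) (M : ℝ)
    (hf : ∀ s, |f s| ≤ M) : |∑ s, p s * f s| ≤ M := by
  calc |∑ s, p s * f s| ≤ ∑ s, |p s * f s| := Finset.abs_sum_le_sum_abs _ _
    _ ≤ ∑ s, p s * M := Finset.sum_le_sum fun s _ => by
        rw [abs_mul, abs_of_nonneg (hp0 s)]
        exact mul_le_mul_of_nonneg_left (hf s) (hp0 s)
    _ = M := by rw [← Finset.sum_mul, hp, one_mul]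

end helpers

/-- quasi-oracle efficiency (finite-setting version): for every `B ≥ 1`
there is a constant `C > 0` (depending only on the MDP, the policies, `d_b`, and `B`)
such that for all bounded nuisance estimates `b, w, q` and every minimizer `ĝ` of
`g ↦ L(b,w,q,g)`, the weighted error `‖ĝ − Q_{πe}‖²_{2,d_b·πe}` is controlled only by
products of sup-norm nuisance estimation errors. -/
theorem quasi_oracle_efficiency
    (S A : Type*) [Fintype S] [Fintype A] [Nonempty S] [Nonempty A] [DecidableEq A]
    (R0 : Finset ℝ)
    (P : S → A → S → ℝ) (hP0 : ∀ s a s', 0 ≤ P s a s')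
    (hP1 : ∀ s a, ∑ s' : S, P s a s' = 1)
    (pr : S → A → ℝ → ℝ) (hpr0 : ∀ s a, ∀ r ∈ R0, 0 ≤ pr s a r)
    (hpr1 : ∀ s a, ∑ r ∈ R0, pr s a r = 1)
    (rbar : S → A → ℝ) (hrbar : ∀ s a, rbar s a = ∑ r ∈ R0, r * pr s a r)
    (γ : ℝ) (hγ0 : 0 < γ) (hγ1 : γ < 1)
    (πb : S → A → ℝ) (hπb0 : ∀ s a, 0 < πb s a) (hπb1 : ∀ s, ∑ a : A, πb s a = 1)
    (πe : S → A → ℝ) (hπe0 : ∀ s a, 0 ≤ πe s a) (hπe1 : ∀ s, ∑ a : A, πe s a = 1)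
    (db : S → ℝ) (hdb0 : ∀ s, 0 < db s) (hdb1 : ∑ s : S, db s = 1)
    (Q : S → A → ℝ)
    (hQ : ∀ s a, Q s a =
      rbar s a + γ * ∑ s' : S, P s a s' * ∑ a' : A, πe s' a' * Q s' a')
    :
    ∀ B : ℝ, 1 ≤ B → ∃ C : ℝ, 0 < C ∧
      ∀ b : S → A → ℝ, (∀ s a, 1 / B ≤ b s a ∧ b s a ≤ B) →
      ∀ w : S → S → A → ℝ, (∀ s' s a, |w s' s a| ≤ B) →
      ∀ q : S → A → ℝ, (∀ s a, |q s a| ≤ B) →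
      ∀ ghat : S → A → ℝ,
        (∀ g : S → A → ℝ,
          Lloss R0 P pr γ πb πe db b w q ghat ≤ Lloss R0 P pr γ πb πe db b w q g) →
        wnormSq db πe (fun s a => ghat s a - Q s a)
          ≤ C * ((⨆ p : S × A, |b p.1 p.2 - πb p.1 p.2|) ^ 4
              + (⨆ p : S × A, |b p.1 p.2 - πb p.1 p.2|) ^ 2
                  * (⨆ p : S × A, |q p.1 p.2 - Q p.1 p.2|) ^ 2
              + (⨆ p : S × A, |b p.1 p.2 - πb p.1 p.2|) ^ 2
                  * (⨆ x : S × S × A,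
                      |w x.1 x.2.1 x.2.2 - wstar P πe γ db x.1 x.2.1 x.2.2|) ^ 2
              + (⨆ x : S × S × A,
                      |w x.1 x.2.1 x.2.2 - wstar P πe γ db x.1 x.2.1 x.2.2|) ^ 2
                  * (⨆ p : S × A, |q p.1 p.2 - Q p.1 p.2|) ^ 2) := by
  intro B hB
  have hB0 : 0 < B := by linarith
  refine ⟨32 * B ^ 4, by positivity, ?_⟩
  intro b hb w hw q hq ghat hmin
  generalize hβ : (⨆ p : S × A, |b p.1 p.2 - πb p.1 p.2|) = β
  generalize hκ : (⨆ p : S × A, |q p.1 p.2 - Q p.1 p.2|) = κ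
  generalize hω : (⨆ x : S × S × A,
    |w x.1 x.2.1 x.2.2 - wstar P πe γ db x.1 x.2.1 x.2.2|) = ω
  have bβ : ∀ s a, |b s a - πb s a| ≤ β := fun s a => by
    rw [← hβ]
    exact le_ciSup (f := fun p : S × A => |b p.1 p.2 - πb p.1 p.2|)
      (Set.finite_range _).bddAbove (s, a)
  have bκ : ∀ s a, |q s a - Q s a| ≤ κ := fun s a => by
    rw [← hκ]
    exact le_ciSup (f := fun p : S × A => |q p.1 p.2 - Q p.1 p.2|)
      (Set.finite_range _).bddAbove (s, a)
  have bω : ∀ s' s a, |w s' s a - wstar P πe γ db s' s a| ≤ ω := fun s' s a => by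
    rw [← hω]
    exact le_ciSup (f := fun x : S × S × A =>
      |w x.1 x.2.1 x.2.2 - wstar P πe γ db x.1 x.2.1 x.2.2|)
      (Set.finite_range _).bddAbove (s', s, a)
  clear hβ hκ hω
  obtain ⟨s0⟩ := ‹Nonempty S›
  obtain ⟨a0⟩ := ‹Nonempty A›
  have β0 : 0 ≤ β := (abs_nonneg _).trans (bβ s0 a0)
  have κ0 : 0 ≤ κ := (abs_nonneg _).trans (bκ s0 a0)
  have ω0 : 0 ≤ ω := (abs_nonneg _).trans (bω s0 s0 a0)
  let D : S → A → ℝ := fun s a => (∑ r ∈ R0, r * pr s a r)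
      + γ * (∑ st, P s a st * ∑ a2, πe st a2 * q st a2) - q s a
  let h : S → A → ℝ := fun s a => q s a + πb s a / b s a * D s a
      + ∑ x, ∑ y, db x * πb x y * (πe x y / b x y * w x s a * D x y)
  let v : S → ℝ := fun s => ∑ a, πe s a * (Q s a - q s a)
  have hDe : ∀ s a, D s a = (Q s a - q s a) - γ * ∑ x, P s a x * v x := by
    intro s a
    simp only [D, v, mul_sub, Finset.sum_sub_distrib]
    rw [← hrbar]
    have := hQ s a
    linarith
  have bv : ∀ s, |v s| ≤ κ := fun s => aux_avg (πe s) (hπe0 s) (hπe1 s) _ κ fun a => by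
    rw [abs_sub_comm]; exact bκ s a
  have bD : ∀ s a, |D s a| ≤ 2 * κ := by
    intro s a
    have h1 := aux_avg (P s a) (hP0 s a) (hP1 s a) v κ bv
    have h2 := bκ s a
    rw [hDe, abs_le]
    rw [abs_le] at h1 h2
    constructor <;> nlinarith
  have hvD : ∀ x, ∑ y, πe x y * D x y = v x - γ * ∑ y, πe x y * ∑ z, P x y z * v z := by
    intro x
    have hv : v x = ∑ a, πe x a * (Q x a - q x a) := rfl
    rw [hv, Finset.mul_sum, ← Finset.sum_sub_distrib]
    exact Finset.sum_congr rfl fun y _ => by rw [hDe]; ring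
  have hQrep : ∀ s a, Q s a = q s a + D s a
      + ∑ x, ∑ y, db x * (πe x y * (wstar P πe γ db x s a * D x y)) := by
    intro s a
    have h1 := aux_occ P hP0 hP1 πe hπe0 hπe1 γ hγ0 hγ1 db hdb0 v s a
    simp only [← hvD] at h1
    have h2 : ∑ x, ∑ y, db x * (πe x y * (wstar P πe γ db x s a * D x y))
        = γ * ∑ x, P s a x * v x := by
      rw [← h1]
      refine Finset.sum_congr rfl fun x _ => ?_
      rw [Finset.mul_sum]
      exact Finset.sum_congr rfl fun y _ => by ring
    rw [h2, hDe]; ring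
  have hratio : ∀ s a, |πb s a / b s a - 1| ≤ B * β := by
    intro s a
    have hb1 := (hb s a).1
    have hbpos : 0 < b s a := lt_of_lt_of_le (by positivity) hb1
    have : πb s a / b s a - 1 = (1 / b s a) * (πb s a - b s a) := by field_simp
    rw [this, abs_mul, abs_of_pos (by positivity : 0 < 1 / b s a)]
    have h1 : 1 / b s a ≤ B := by
      rw [div_le_iff₀ hbpos]
      rw [div_le_iff₀ hB0] at hb1
      linarith
    rw [abs_sub_comm]
    exact mul_le_mul h1 (bβ s a) (abs_nonneg _) hB0.le
  have hdiff : ∀ s a, |h s a - Q s a| ≤ 2 * κ * (2 * B ^ 2 * β + ω) := by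
    intro s a
    have hrep : h s a - Q s a = (πb s a / b s a - 1) * D s a
        + ∑ x, db x * ∑ y, πe x y * (((πb x y / b x y - 1) * w x s a
            + (w x s a - wstar P πe γ db x s a)) * D x y) := by
      rw [hQrep s a]
      simp only [h, Finset.mul_sum]
      have : ∀ X Y Z : ℝ, X - Y = Z → q s a + πb s a / b s a * D s a + X - (q s a + D s a + Y)
        = (πb s a / b s a - 1) * D s a + Z := by
        intro X Y Z hZ; rw [← hZ]; ring
      apply this
      simp only [← Finset.sum_sub_distrib]
      exact Finset.sum_congr rfl fun x _ => Finset.sum_congr rfl fun y _ => by ring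
    have t1 : |(πb s a / b s a - 1) * D s a| ≤ B * β * (2 * κ) := by
      rw [abs_mul]
      exact mul_le_mul (hratio s a) (bD s a) (abs_nonneg _) (by positivity)
    have t2 : |∑ x, db x * ∑ y, πe x y * (((πb x y / b x y - 1) * w x s a
            + (w x s a - wstar P πe γ db x s a)) * D x y)| ≤ (B * β * B + ω) * (2 * κ) := by
      refine aux_avg db (fun x => (hdb0 x).le) hdb1 _ _ fun x => ?_
      refine aux_avg (πe x) (hπe0 x) (hπe1 x) _ _ fun y => ?_
      rw [abs_mul]
      refine mul_le_mul ?_ (bD x y) (abs_nonneg _) (by positivity)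
      refine (abs_add_le _ _).trans (add_le_add ?_ (bω x s a))
      rw [abs_mul]
      exact mul_le_mul (hratio x y) (hw x s a) (abs_nonneg _) (by positivity)
    rw [hrep]
    refine (abs_add_le _ _).trans ?_
    have h3 : B * (β * κ) ≤ B ^ 2 * (β * κ) :=
      mul_le_mul_of_nonneg_right (by nlinarith) (by positivity)
    nlinarith
  have hz : wnormSq db πe (fun s a => ghat s a - h s a) ≤ 0 := by
    have h1 := aux_loss R0 P hP1 pr hpr1 γ πb hπb1 πe db hdb1 b w q ghat h D
      (fun _ _ => rfl) (fun _ _ => rfl)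
    have h2 := hmin h
    linarith
  have hnn : ∀ s a, 0 ≤ db s * πe s a * (ghat s a - h s a) ^ 2 := fun s a =>
    mul_nonneg (mul_nonneg (hdb0 s).le (hπe0 s a)) (sq_nonneg _)
  have hz2 : ∀ s a, db s * πe s a * (ghat s a - h s a) ^ 2 = 0 := by
    have h1 : wnormSq db πe (fun s a => ghat s a - h s a) = 0 :=
      le_antisymm hz (Finset.sum_nonneg fun s _ => Finset.sum_nonneg fun a _ => hnn s a)
    unfold wnormSq at h1
    intro s a
    have h2 := (Finset.sum_eq_zero_iff_of_nonneg fun s _ =>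
      Finset.sum_nonneg fun a _ => hnn s a).1 h1 s (Finset.mem_univ s)
    exact (Finset.sum_eq_zero_iff_of_nonneg fun a _ => hnn s a).1 h2 a (Finset.mem_univ a)
  have hpt : ∀ s a, db s * πe s a * (ghat s a - Q s a) ^ 2
      ≤ db s * πe s a * (2 * κ * (2 * B ^ 2 * β + ω)) ^ 2 := by
    intro s a
    rcases mul_eq_zero.1 (hz2 s a) with h0 | h0
    · simp [h0]
    · have h1 : ghat s a = h s a := by
        have := pow_eq_zero_iff (two_ne_zero) |>.1 h0
        linarith
      rw [h1]
      exact mul_le_mul_of_nonneg_left (sq_le_sq' (abs_le.1 (hdiff s a)).1 (abs_le.1 (hdiff s a)).2)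
        (mul_nonneg (hdb0 s).le (hπe0 s a))
  have hfin : wnormSq db πe (fun s a => ghat s a - Q s a)
      ≤ (2 * κ * (2 * B ^ 2 * β + ω)) ^ 2 := by
    unfold wnormSq
    refine (Finset.sum_le_sum fun s _ => Finset.sum_le_sum fun a _ => hpt s a).trans ?_
    simp only [← Finset.sum_mul, ← Finset.mul_sum, hπe1, mul_one, hdb1, one_mul, le_refl]
  refine hfin.trans ?_
  have hB4 : 1 ≤ B ^ 4 := one_le_pow₀ hB
  have i1 : (2 * B ^ 2 * β + ω) ^ 2 ≤ 8 * B ^ 4 * β ^ 2 + 2 * ω ^ 2 := by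
    nlinarith [sq_nonneg (2 * B ^ 2 * β - ω)]
  have i2 : 2 * ω ^ 2 ≤ 8 * B ^ 4 * ω ^ 2 := by nlinarith [sq_nonneg ω]
  have i3 : (2 * κ * (2 * B ^ 2 * β + ω)) ^ 2 ≤ 4 * κ ^ 2 * (8 * B ^ 4 * β ^ 2 + 8 * B ^ 4 * ω ^ 2) := by
    rw [mul_pow, mul_pow]
    have : (0:ℝ) ≤ 2 ^ 2 * κ ^ 2 := by positivity
    calc _ ≤ 2 ^ 2 * κ ^ 2 * (8 * B ^ 4 * β ^ 2 + 8 * B ^ 4 * ω ^ 2) :=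
          mul_le_mul_of_nonneg_left (by linarith) this
      _ = _ := by ring
  have i4 : 0 ≤ 32 * B ^ 4 * (β ^ 4 + β ^ 2 * ω ^ 2) := by positivity
  nlinarith
end

section
/- The efficient influence function of the Q-function has mean zero: for every (s₀,a₀) ∈ S×A, E_{o'∼p_b}[ ( 𝟙{s'=s₀ and a'=a₀}/(d_b(s₀)·πb(a₀|s₀)) + (πe(a'|s')/πb(a'|s'))·w*(s',s₀,a₀) ) · ( r' + γ·v_{πe}(s̃') − Q_{πe}(s',a') ) ] = 0, where the expectation is over observations o' = (s',a',r',s̃') drawn from the observational one-step distribution p_b. -/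
open Finset

/-- the efficient influence function of the Q-function has mean zero:
for every `(s₀,a₀)`,
`E_{o'∼p_b}[(𝟙{s'=s₀, a'=a₀}/(d_b(s₀)·πb(a₀|s₀)) + (πe(a'|s')/πb(a'|s'))·w*(s',s₀,a₀))·(r' + γ·v_{πe}(s̃') − Q_{πe}(s',a'))] = 0`,
where `o' = (s',a',r',s̃') ∼ p_b` and `v_{πe}(s̃) = Σ_ã πe(ã|s̃)·Q_{πe}(s̃,ã)`. -/
theorem eif_of_Q_has_mean_zero
    (S A : Type*) [Fintype S] [Fintype A] [Nonempty S] [Nonempty A]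
    [DecidableEq S] [DecidableEq A]
    (R0 : Finset ℝ)
    (P : S → A → S → ℝ) (hP0 : ∀ s a s', 0 ≤ P s a s')
    (hP1 : ∀ s a, ∑ s' : S, P s a s' = 1)
    (pr : S → A → ℝ → ℝ) (hpr0 : ∀ s a, ∀ r ∈ R0, 0 ≤ pr s a r)
    (hpr1 : ∀ s a, ∑ r ∈ R0, pr s a r = 1)
    (rbar : S → A → ℝ) (hrbar : ∀ s a, rbar s a = ∑ r ∈ R0, r * pr s a r)
    (γ : ℝ) (hγ0 : 0 < γ) (hγ1 : γ < 1)
    (πb : S → A → ℝ) (hπb0 : ∀ s a, 0 < πb s a) (hπb1 : ∀ s, ∑ a : A, πb s a = 1)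
    (πe : S → A → ℝ) (hπe0 : ∀ s a, 0 ≤ πe s a) (hπe1 : ∀ s, ∑ a : A, πe s a = 1)
    (db : S → ℝ) (hdb0 : ∀ s, 0 < db s) (hdb1 : ∑ s : S, db s = 1)
    (Q : S → A → ℝ)
    (hQ : ∀ s a, Q s a =
      rbar s a + γ * ∑ s' : S, P s a s' * ∑ a' : A, πe s' a' * Q s' a')
    (s₀ : S) (a₀ : A) :
    ∑ s' : S, ∑ a' : A, ∑ r' ∈ R0, ∑ st : S,
      db s' * πb s' a' * pr s' a' r' * P s' a' st *
        (((if s' = s₀ ∧ a' = a₀ then (1 : ℝ) else 0) / (db s₀ * πb s₀ a₀)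
            + (πe s' a' / πb s' a') * wstar P πe γ db s' s₀ a₀)
          * (r' + γ * (∑ a2 : A, πe st a2 * Q st a2) - Q s' a')) = 0 := by
  refine Finset.sum_eq_zero fun s _ => Finset.sum_eq_zero fun a _ => ?_
  generalize ((if s = s₀ ∧ a = a₀ then (1 : ℝ) else 0) / (db s₀ * πb s₀ a₀)
            + (πe s a / πb s a) * wstar P πe γ db s s₀ a₀) = W
  have hq := hQ s a
  rw [hrbar] at hq
  generalize hv : (fun st => ∑ a2 : A, πe st a2 * Q st a2) = v
  have hv' : ∀ st, ∑ a2 : A, πe st a2 * Q st a2 = v st := fun st => by rw [← hv]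
  simp only [hv'] at hq ⊢
  have h1 : ∀ r ∈ R0, ∑ st : S, db s * πb s a * pr s a r * P s a st *
      (W * (r + γ * v st - Q s a))
      = db s * πb s a * W * (r * pr s a r)
        + db s * πb s a * W * (γ * ∑ st, P s a st * v st - Q s a) * pr s a r := by
    intro r _
    have h2 : ∀ st, db s * πb s a * pr s a r * P s a st * (W * (r + γ * v st - Q s a))
        = db s * πb s a * pr s a r * W * (r - Q s a) * P s a st
          + db s * πb s a * pr s a r * W * γ * (P s a st * v st) := fun st => by ring
    simp only [h2]
    rw [Finset.sum_add_distrib, ← Finset.mul_sum, ← Finset.mul_sum, hP1]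
    ring
  rw [Finset.sum_congr rfl h1, Finset.sum_add_distrib, ← Finset.mul_sum, ← Finset.mul_sum, hpr1]
  linear_combination (-(db s * πb s a * W)) * hq
end
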